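/- arXiv:1512.05632 — 2 statements merged into one kernel-verified Lean document; each statement's English description precedes it below -/
import Mathlib

section
/- For every real r > 1 there exists a constant c_r > 0 such that for all positive integers k, ℓ, m for which the (k,ℓ,m)-metafunnel has n ≥ 3 vertices, the discrete-time Moran process with fitness r on the (k,ℓ,m)-metafunnel, started from a single initial mutant placed at a uniformly random vertex, has extinction probability at least e^{−√(log r · log n)}·(log n)^{−c_r}. -/
open Finset

/-- Total fitness of the mutant set `S` (mutants have fitness `r`, non-mutants fitness `1`). -/
noncomputable def moranW {V : Type*} [Fintype V] (r : ℝ) (S : Finset V) : ℝ :=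
  r * S.card + ((Fintype.card V : ℝ) - S.card)

/-- One-step transition probability of the Moran process with fitness `r` and
reproduction weights `w`, from mutant set `S` to mutant set `T`:  a vertex `u` is chosen
with probability `r / moranW r S` if it is a mutant and `1 / moranW r S` otherwise, then a
target `v` is chosen with probability `w u v`, and `v` becomes a mutant if `u` is one and
a non-mutant otherwise. -/
noncomputable def moranStep {V : Type*} [Fintype V] [DecidableEq V]
    (r : ℝ) (w : V → V → ℝ) (S T : Finset V) : ℝ :=
  ∑ u : V, ∑ v : V,
    ((if u ∈ S then r else 1) / moranW r S) * w u v *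
      (if (if u ∈ S then insert v S else S.erase v) = T then 1 else 0)

/-- Distribution of the Moran process after `t` steps, from initial distribution `init`. -/
noncomputable def moranDist {V : Type*} [Fintype V] [DecidableEq V]
    (r : ℝ) (w : V → V → ℝ) (init : Finset V → ℝ) : ℕ → Finset V → ℝ
  | 0 => init
  | t + 1 => fun T => ∑ S : Finset V, moranDist r w init t S * moranStep r w S T

/-- Reproduction weights of the (unweighted) Moran process on the digraph with
out-neighbourhoods `out`: the offspring goes to a uniformly random out-neighbour. -/
noncomputable def outWeights {V : Type*} [DecidableEq V]
    (out : V → Finset V) : V → V → ℝ :=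
  fun u v => if v ∈ out u then ((out u).card : ℝ)⁻¹ else 0

/-- Extinction probability: `sup_t Pr(S_t = ∅)`. -/
noncomputable def extinctionProb {V : Type*} [Fintype V] [DecidableEq V]
    (r : ℝ) (w : V → V → ℝ) (init : Finset V → ℝ) : ℝ :=
  ⨆ t : ℕ, moranDist r w init t (∅ : Finset V)

/-- Fixation probability: `sup_t Pr(S_t = V)`. -/
noncomputable def fixationProb {V : Type*} [Fintype V] [DecidableEq V]
    (r : ℝ) (w : V → V → ℝ) (init : Finset V → ℝ) : ℝ :=
  ⨆ t : ℕ, moranDist r w init t (Finset.univ : Finset V)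

/-- Initial distribution: a single mutant at a uniformly random vertex. -/
noncomputable def uniformSingleton (V : Type*) [Fintype V] [DecidableEq V] :
    Finset V → ℝ :=
  fun S => if S.card = 1 then (Fintype.card V : ℝ)⁻¹ else 0

/-- Initial distribution: a single mutant at the fixed vertex `x₀`. -/
def pointInit {V : Type*} [DecidableEq V] (x₀ : V) : Finset V → ℝ :=
  fun S => if S = {x₀} then 1 else 0

/-- Vertices of the `(k,ℓ,m)`-metafunnel: the centre `v*` (`Sum.inl ()`) together with,
for each level index `i : Fin k` (representing level `i+1`) and each copy `j : Fin ℓ`,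
a set `V_{i+1,j}` of `m ^ (i+1)` vertices.  It has `1 + ℓ·∑_{i=1}^k m^i` vertices. -/
abbrev MetafunnelV (k ℓ m : ℕ) : Type :=
  Unit ⊕ (Σ i : Fin k, Fin ℓ × Fin (m ^ ((i : ℕ) + 1)))

/-- The level of a metafunnel vertex: the centre has level `0` and the vertices of
`V_{i,j}` have level `i`. -/
def mfLevel {k ℓ m : ℕ} : MetafunnelV k ℓ m → ℕ
  | Sum.inl _ => 0
  | Sum.inr ⟨i, _⟩ => (i : ℕ) + 1

/-- The copy of a metafunnel vertex: `some j` for a vertex of `V_{i,j}`, and `none` for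
the centre. -/
def mfCopy {k ℓ m : ℕ} : MetafunnelV k ℓ m → Option (Fin ℓ)
  | Sum.inl _ => none
  | Sum.inr ⟨_, j, _⟩ => some j

/-- Out-neighbourhoods of the `(k,ℓ,m)`-metafunnel: the centre points to all of `V_k`,
each vertex of `V_1` points to the centre, and each vertex of `V_{i+1,j}` points to all
of `V_{i,j}`. -/
def metafunnelOut (k ℓ m : ℕ) : MetafunnelV k ℓ m → Finset (MetafunnelV k ℓ m)
  | Sum.inl _ => Finset.univ.filter fun v => mfLevel v = k
  | Sum.inr ⟨i, j, _⟩ =>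
      if (i : ℕ) = 0 then {Sum.inl ()}
      else Finset.univ.filter fun v => mfLevel v = (i : ℕ) ∧ mfCopy v = some j


section abstractPart

variable {V : Type*} [Fintype V] [DecidableEq V]

/-- The next mutant set. -/
def nextSet (S : Finset V) (u v : V) : Finset V := if u ∈ S then insert v S else S.erase v

/-- The reproduction rate. -/
noncomputable def rate (r : ℝ) (S : Finset V) (u : V) : ℝ := if u ∈ S then r else 1

/-- The (unnormalised) generator. -/
noncomputable def gen (r : ℝ) (w : V → V → ℝ) (g : Finset V → ℝ) (S : Finset V) : ℝ :=
  ∑ u : V, ∑ v : V, rate r S u * w u v * (g (nextSet S u v) - g S)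

lemma rate_pos {V : Type*} [DecidableEq V] {r : ℝ} (hr : 1 < r) (S : Finset V) (u : V) : 0 < rate r S u := by
  unfold rate; split_ifs <;> linarith

lemma moranW_eq (r : ℝ) (S : Finset V) : moranW r S = ∑ u : V, rate r S u := by
  have h : ∀ u : V, rate r S u = 1 + (if u ∈ S then (r - 1) else 0) := by
    intro u; unfold rate; split_ifs <;> ring
  simp only [h, Finset.sum_add_distrib, Finset.sum_ite_mem, Finset.univ_inter, Finset.sum_const,
    moranW, Finset.card_univ, nsmul_eq_mul]
  ring

lemma moranW_pos [Nonempty V] {r : ℝ} (hr : 1 < r) (S : Finset V) : 0 < moranW r S := by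
  rw [moranW_eq]
  exact Finset.sum_pos (fun u _ => rate_pos hr S u) Finset.univ_nonempty

lemma step_expect (r : ℝ) (w : V → V → ℝ) (g : Finset V → ℝ) (S : Finset V) :
    ∑ T : Finset V, moranStep r w S T * g T
      = ∑ u : V, ∑ v : V, rate r S u / moranW r S * w u v * g (nextSet S u v) := by
  unfold moranStep
  simp only [Finset.sum_mul]
  rw [Finset.sum_comm]
  refine Finset.sum_congr rfl fun u _ => ?_
  rw [Finset.sum_comm]
  refine Finset.sum_congr rfl fun v _ => ?_
  simp only [rate, nextSet]
  simp [mul_assoc]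

lemma step_sum_one [Nonempty V] {r : ℝ} (hr : 1 < r) {w : V → V → ℝ}
    (hw1 : ∀ u, ∑ v, w u v = 1) (S : Finset V) :
    ∑ u : V, ∑ v : V, rate r S u / moranW r S * w u v = 1 := by
  simp only [← Finset.mul_sum, hw1, mul_one]
  rw [← Finset.sum_div, ← moranW_eq]
  exact div_self (moranW_pos hr S).ne'

lemma step_expect_gen [Nonempty V] {r : ℝ} (hr : 1 < r) {w : V → V → ℝ}
    (hw1 : ∀ u, ∑ v, w u v = 1) (g : Finset V → ℝ) (S : Finset V) :
    ∑ T : Finset V, moranStep r w S T * g T = g S + gen r w g S / moranW r S := by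
  rw [step_expect]
  have h := step_sum_one hr hw1 S
  have h2 : gen r w g S / moranW r S =
      ∑ u : V, ∑ v : V, rate r S u / moranW r S * w u v * g (nextSet S u v)
      - (∑ u : V, ∑ v : V, rate r S u / moranW r S * w u v) * g S := by
    unfold gen
    simp only [Finset.sum_div, Finset.sum_mul]
    rw [← Finset.sum_sub_distrib]
    refine Finset.sum_congr rfl fun u _ => ?_
    rw [← Finset.sum_sub_distrib]
    refine Finset.sum_congr rfl fun v _ => ?_
    ring
  rw [h2, h]; ring

lemma step_nonneg [Nonempty V] {r : ℝ} (hr : 1 < r) {w : V → V → ℝ}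
    (hw0 : ∀ u v, 0 ≤ w u v) (S T : Finset V) : 0 ≤ moranStep r w S T := by
  unfold moranStep
  refine Finset.sum_nonneg fun u _ => Finset.sum_nonneg fun v _ => ?_
  have h1 := rate_pos hr S u
  unfold rate at h1
  have h2 := moranW_pos hr S
  refine mul_nonneg (mul_nonneg (div_nonneg h1.le h2.le) (hw0 u v)) ?_
  split_ifs <;> norm_num

lemma dist_nonneg' [Nonempty V] {r : ℝ} (hr : 1 < r) {w : V → V → ℝ}
    (hw0 : ∀ u v, 0 ≤ w u v) {init : Finset V → ℝ} (hi : ∀ S, 0 ≤ init S) (t : ℕ) :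
    ∀ S, 0 ≤ moranDist r w init t S := by
  induction t with
  | zero => exact hi
  | succ t ih =>
    intro T
    exact Finset.sum_nonneg fun S _ => mul_nonneg (ih S) (step_nonneg hr hw0 S T)

lemma dist_expect_succ (r : ℝ) (w : V → V → ℝ) (init : Finset V → ℝ) (g : Finset V → ℝ) (t : ℕ) :
    ∑ T : Finset V, moranDist r w init (t + 1) T * g T
      = ∑ S : Finset V, moranDist r w init t S * ∑ T : Finset V, moranStep r w S T * g T := by
  simp only [moranDist, Finset.sum_mul, Finset.mul_sum]
  rw [Finset.sum_comm]
  simp only [mul_assoc]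

lemma dist_sum [Nonempty V] {r : ℝ} (hr : 1 < r) {w : V → V → ℝ}
    (hw1 : ∀ u, ∑ v, w u v = 1) {init : Finset V → ℝ} (h1 : ∑ S, init S = 1) (t : ℕ) :
    ∑ S, moranDist r w init t S = 1 := by
  induction t with
  | zero => exact h1
  | succ t ih =>
    have h := dist_expect_succ r w init (fun _ => 1) t
    have h2 := step_expect_gen hr hw1 (fun _ : Finset V => (1 : ℝ))
    simp only [gen, sub_self, mul_zero, Finset.sum_const_zero, zero_div, add_zero,
      mul_one] at h h2
    rw [h]
    simp only [h2, mul_one, ih]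

lemma gen_empty (r : ℝ) (w : V → V → ℝ) (g : Finset V → ℝ) : gen r w g ∅ = 0 := by
  simp [gen, nextSet]

/-- Lower bound for the extinction probability via a submartingale. -/
lemma ext_ge_of_sub [Nonempty V] {r : ℝ} (hr : 1 < r) {w : V → V → ℝ}
    (hw0 : ∀ u v, 0 ≤ w u v) (hw1 : ∀ u, ∑ v, w u v = 1)
    {init : Finset V → ℝ} (hi : ∀ S, 0 ≤ init S) (h1 : ∑ S, init S = 1)
    (g : Finset V → ℝ) (hg0 : ∀ S, 0 ≤ g S) (hge : g ∅ ≤ 1)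
    (hg : ∀ S, S ≠ ∅ → 0 < g S → 0 < gen r w g S) :
    ∑ S, init S * g S ≤ extinctionProb r w init := by
  have hd0 := dist_nonneg' hr hw0 hi
  have hdle : ∀ t S, moranDist r w init t S ≤ 1 := fun t S => by
    rw [← dist_sum hr hw1 h1 t]
    exact Finset.single_le_sum (fun T _ => hd0 t T) (Finset.mem_univ S)
  have hext : ∀ t, moranDist r w init t ∅ ≤ extinctionProb r w init := fun t =>
    le_ciSup (f := fun t => moranDist r w init t ∅)
      ⟨1, by rintro _ ⟨t, rfl⟩; exact hdle t ∅⟩ t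
  -- uniform multiplicative drift
  obtain ⟨δ, hδ, hdr⟩ : ∃ δ > 0, ∀ S, S ≠ ∅ → δ * g S ≤ gen r w g S / moranW r S := by
    have h : ∀ S : Finset V, ∃ δ > 0, S ≠ ∅ → 0 < g S → δ * g S ≤ gen r w g S / moranW r S := by
      intro S
      by_cases hS : S ≠ ∅ ∧ 0 < g S
      · refine ⟨gen r w g S / moranW r S / g S,
          div_pos (div_pos (hg S hS.1 hS.2) (moranW_pos hr S)) hS.2, fun _ _ => ?_⟩
        rw [div_mul_cancel₀ _ hS.2.ne']
      · exact ⟨1, one_pos, fun a b => absurd ⟨a, b⟩ hS⟩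
    choose δ hδ hdr using h
    refine ⟨Finset.univ.inf' Finset.univ_nonempty δ, ?_, fun S hS => ?_⟩
    · exact (Finset.lt_inf'_iff _).2 fun S _ => hδ S
    · rcases (hg0 S).eq_or_lt with h0 | h0
      · rw [← h0, mul_zero]
        refine div_nonneg ?_ (moranW_pos hr S).le
        unfold gen
        refine Finset.sum_nonneg fun u _ => Finset.sum_nonneg fun v _ => ?_
        rw [← h0, sub_zero]
        exact mul_nonneg (mul_nonneg (rate_pos hr S u).le (hw0 u v)) (hg0 _)
      · refine le_trans ?_ (hdr S hS h0)
        exact mul_le_mul_of_nonneg_right (Finset.inf'_le _ (Finset.mem_univ S)) h0.le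
  by_contra hcon
  push Not at hcon
  set e := extinctionProb r w init
  set M : ℕ → ℝ := fun t => ∑ S, moranDist r w init t S * g S with hM
  have hM0 : e < M 0 := hcon
  have hstep : ∀ t, M t + δ * (M t - e) ≤ M (t + 1) := by
    intro t
    have h2 : M (t + 1) = M t + ∑ S, moranDist r w init t S * (gen r w g S / moranW r S) := by
      simp only [hM]
      rw [dist_expect_succ, ← Finset.sum_add_distrib]
      refine Finset.sum_congr rfl fun S _ => ?_
      rw [step_expect_gen hr hw1]; ring
    rw [h2]
    have h3 : ∑ S, moranDist r w init t S * (δ * g S - if S = ∅ then δ else 0)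
        ≤ ∑ S, moranDist r w init t S * (gen r w g S / moranW r S) := by
      refine Finset.sum_le_sum fun S _ => mul_le_mul_of_nonneg_left ?_ (hd0 t S)
      split_ifs with hS
      · subst hS
        rw [gen_empty, zero_div]
        nlinarith
      · rw [sub_zero]; exact hdr S hS
    have h4 : ∑ S, moranDist r w init t S * (δ * g S - if S = ∅ then δ else 0)
        = δ * M t - δ * moranDist r w init t ∅ := by
      simp only [mul_sub, Finset.sum_sub_distrib, mul_ite, mul_zero, Finset.sum_ite_eq',
        Finset.mem_univ, if_true, hM, Finset.mul_sum]
      congr 1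
      · exact Finset.sum_congr rfl fun S _ => by ring
      · simp [mul_comm]
    have h5 := mul_le_mul_of_nonneg_left (hext t) hδ.le
    linarith
  have hgrow : ∀ t : ℕ, M 0 + t * (δ * (M 0 - e)) ≤ M t := by
    intro t
    have hη : 0 < δ * (M 0 - e) := mul_pos hδ (by linarith)
    induction t with
    | zero => simp
    | succ t ih =>
      have h6 : M 0 ≤ M t := by
        have : 0 ≤ (t : ℝ) * (δ * (M 0 - e)) := by positivity
        linarith
      have h7 := hstep t
      have h8 := mul_le_mul_of_nonneg_left (sub_le_sub_right h6 e) hδ.le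
      push_cast
      linarith
  have hbd : ∀ t, M t ≤ ∑ S, g S := fun t =>
    Finset.sum_le_sum fun S _ => by
      have := mul_le_mul_of_nonneg_right (hdle t S) (hg0 S)
      linarith
  obtain ⟨t, ht⟩ := exists_nat_gt ((∑ S, g S - M 0) / (δ * (M 0 - e)))
  have hη : 0 < δ * (M 0 - e) := mul_pos hδ (by linarith)
  rw [div_lt_iff₀ hη] at ht
  linarith [hgrow t, hbd t]

lemma init_nonneg (S : Finset V) : 0 ≤ uniformSingleton V S := by
  unfold uniformSingleton; split_ifs <;> positivity

lemma init_expect (g : Finset V → ℝ) :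
    ∑ S, uniformSingleton V S * g S = ∑ x : V, (Fintype.card V : ℝ)⁻¹ * g {x} := by
  have h : (Finset.univ.filter fun S : Finset V => S.card = 1)
      = Finset.univ.image (fun x : V => ({x} : Finset V)) := by
    ext S; simp [Finset.card_eq_one, eq_comm]
  simp only [uniformSingleton, ite_mul, zero_mul]
  rw [← Finset.sum_filter, h, Finset.sum_image]
  intro x _ y _ hxy
  simpa using hxy

lemma init_sum [Nonempty V] : ∑ S, uniformSingleton V S = 1 := by
  have := init_expect (V := V) (fun _ => 1)
  simp only [mul_one, Finset.sum_const, Finset.card_univ, nsmul_eq_mul] at this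
  rw [this, mul_inv_cancel₀]
  exact_mod_cast Fintype.card_ne_zero

lemma ext_ge_uniform [Nonempty V] {r : ℝ} (hr : 1 < r) {w : V → V → ℝ}
    (hw0 : ∀ u v, 0 ≤ w u v) (hw1 : ∀ u, ∑ v, w u v = 1)
    (g : Finset V → ℝ) (hg0 : ∀ S, 0 ≤ g S) (hge : g ∅ ≤ 1)
    (hg : ∀ S, S ≠ ∅ → 0 < g S → 0 < gen r w g S) (X : Finset V) (p : ℝ)
    (hp : ∀ x ∈ X, p ≤ g {x}) :
    (X.card : ℝ) / (Fintype.card V : ℝ) * p ≤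
      extinctionProb r w (uniformSingleton V) := by
  refine le_trans ?_ (ext_ge_of_sub hr hw0 hw1 init_nonneg init_sum g hg0 hge hg)
  rw [init_expect]
  calc (X.card : ℝ) / (Fintype.card V : ℝ) * p = ∑ x ∈ X, (Fintype.card V : ℝ)⁻¹ * p := by
        rw [Finset.sum_const, nsmul_eq_mul]; ring
    _ ≤ ∑ x ∈ X, (Fintype.card V : ℝ)⁻¹ * g {x} :=
        Finset.sum_le_sum fun x hx => mul_le_mul_of_nonneg_left (hp x hx) (by positivity)
    _ ≤ ∑ x, (Fintype.card V : ℝ)⁻¹ * g {x} :=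
        Finset.sum_le_sum_of_subset_of_nonneg (Finset.subset_univ _)
          fun x _ _ => mul_nonneg (by positivity) (hg0 _)

/-- Linear potential: generator bound. -/
lemma gen_linear {r : ℝ} (hr : 1 < r) {w : V → V → ℝ}
    (hw0 : ∀ u v, 0 ≤ w u v) (a : V → ℝ) (ha : ∀ v, 0 ≤ a v) (S : Finset V) :
    gen r w (fun S => ∑ v ∈ S, a v) S ≤
      ∑ u ∈ S, (r * ∑ v, w u v * a v - (∑ v, w v u) * a u) := by
  have h1 : ∑ u ∈ S, (r * ∑ v, w u v * a v - (∑ v, w v u) * a u)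
      = ∑ u : V, ∑ v : V, ((if u ∈ S then r * (w u v * a v) else 0)
          - (if v ∈ S then w u v * a v else 0)) := by
    simp only [Finset.sum_sub_distrib]
    congr 1
    · simp only [Finset.mul_sum]
      rw [← Finset.sum_filter_add_sum_filter_not (s := Finset.univ) (p := fun u => u ∈ S)]
      rw [Finset.sum_congr rfl (g := fun _ => (0 : ℝ)) (s₁ := Finset.univ.filter fun u => ¬ u ∈ S)]
      · simp only [Finset.sum_const_zero, add_zero, Finset.filter_univ_mem]
        exact Finset.sum_congr rfl fun u hu => by simp [hu]
      · intro u hu; simp at hu; simp [hu]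
    · rw [Finset.sum_comm]
      simp only [Finset.sum_mul]
      rw [← Finset.sum_filter_add_sum_filter_not (s := Finset.univ) (p := fun u => u ∈ S)]
      rw [Finset.sum_congr rfl (g := fun _ => (0 : ℝ)) (s₁ := Finset.univ.filter fun u => ¬ u ∈ S)]
      · simp only [Finset.sum_const_zero, add_zero, Finset.filter_univ_mem]
        exact Finset.sum_congr rfl fun u hu => by simp [hu]
      · intro u hu; simp at hu; simp [hu]
  rw [h1]
  unfold gen
  refine Finset.sum_le_sum fun u _ => Finset.sum_le_sum fun v _ => ?_
  have hwa := mul_nonneg (hw0 u v) (ha v)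
  by_cases hu : u ∈ S <;> by_cases hv : v ∈ S
  · simp only [rate, nextSet, hu, hv, if_true, Finset.insert_eq_of_mem, sub_self, mul_zero]
    nlinarith
  · simp only [rate, nextSet, hu, hv, if_true, if_false, Finset.sum_insert hv]
    apply le_of_eq; ring
  · simp only [rate, nextSet, hu, hv, if_true, if_false, Finset.sum_erase_eq_sub hv]
    apply le_of_eq; ring
  · simp [rate, nextSet, hu, hv]

/-- Singleton potential. -/
lemma ext_singleton [Nonempty V] {r : ℝ} (hr : 1 < r) {w : V → V → ℝ}
    (hw0 : ∀ u v, 0 ≤ w u v) (hw1 : ∀ u, ∑ v, w u v = 1) (hl : ∀ u, w u u = 0)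
    (X : Finset V) (hX : ∀ x ∈ X, 1 ≤ ∑ u, w u x) :
    (X.card : ℝ) / (Fintype.card V : ℝ) * (1 / (2 + r)) ≤
      extinctionProb r w (uniformSingleton V) := by
  have hq0 : 0 < 1 / (2 + r) := by positivity
  have hqe : 1 / (2 + r) * (2 + r) = 1 := by field_simp
  generalize 1 / (2 + r) = q at *
  classical
  set g : Finset V → ℝ := fun S => if S = ∅ then 1 else if ∃ x ∈ X, S = {x} then q else 0 with hgdef
  have hgs : ∀ x ∈ X, g {x} = q := fun x hx => by simp [hgdef, hx]
  have hg0 : ∀ S, 0 ≤ g S := by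
    intro S; simp only [hgdef]; split_ifs <;> linarith
  refine ext_ge_uniform hr hw0 hw1 g hg0 (by simp [hgdef]) ?_ X q (fun x hx => (hgs x hx).ge)
  intro S hS hpos
  obtain ⟨x, hx, rfl⟩ : ∃ x ∈ X, S = {x} := by
    by_contra h
    simp only [hgdef, hS, h, if_false] at hpos
    exact lt_irrefl _ hpos
  have hlow : ∑ u : V, ∑ v : V, ((if v = x then w u v * (1 - q) else 0)
      - (if u = x then r * q * w u v else 0)) ≤ gen r w g {x} := by
    unfold gen
    refine Finset.sum_le_sum fun u _ => Finset.sum_le_sum fun v _ => ?_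
    rw [hgs x hx]
    by_cases hu : u = x <;> by_cases hv : v = x
    · subst hu; subst hv; simp [hl]
    · subst hu
      have := mul_nonneg (hw0 u v) (hg0 (nextSet {u} u v))
      simp only [hv, rate, Finset.mem_singleton, if_true, if_false]
      nlinarith
    · subst hv
      simp [hu, rate, nextSet, hgdef]
    · have : nextSet {x} u v = {x} := by
        simp [nextSet, hu, hv]
      rw [this, hgs x hx]; simp [hu, hv]
  refine lt_of_lt_of_le ?_ hlow
  simp only [Finset.sum_sub_distrib, Finset.sum_ite_eq', Finset.mem_univ, if_true]
  rw [Finset.sum_comm (f := fun u v => if u = x then r * q * w u v else 0)]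
  simp only [Finset.sum_ite_eq', Finset.mem_univ, if_true, ← Finset.mul_sum, hw1,
    ← Finset.sum_mul]
  have := hX x hx
  nlinarith

/-- Main potential argument. -/
lemma ext_main [Nonempty V] {r : ℝ} (hr : 1 < r) {w : V → V → ℝ}
    (hw0 : ∀ u v, 0 ≤ w u v) (hw1 : ∀ u, ∑ v, w u v = 1)
    (K : Finset V) (z : V) (hz : z ∉ K)
    (hzK : ∀ v, v ∉ K → w z v = 0) (hK : ∀ u, u ≠ z → ∀ v ∈ K, w u v = 0)
    (a : V → ℝ) (ha : ∀ v, 0 ≤ a v) (haK : ∀ v ∈ K, a v = 0)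
    (A B p d q δ : ℝ) (hB : 0 < B) (hp : 0 < p) (hp1 : p ≤ 1) (hAB : A = 2 * p * B)
    (h1 : ∀ u, u ∉ K → u ≠ z → r * ∑ v, w u v * a v < (∑ v, w v u) * a u)
    (hd : (∑ v, w v z) * a z = d)
    (hq : ∀ u ∈ K, r * ∑ v, w u v * a v ≤ q) 
    (hδ : ∀ u ∈ K, w z u = δ)
    (hc1 : r < B * d) (hc2 : A * q < (1 / 2 - p) * δ) (hc3 : A * q + r * p < A * d) :
    (K.card : ℝ) / (Fintype.card V : ℝ) * p ≤
      extinctionProb r w (uniformSingleton V) := by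
  have hA : 0 < A := by rw [hAB]; positivity
  set Ψ : Finset V → ℝ := fun S => ∑ v ∈ S, a v with hΨ
  have hΨ0 : ∀ S, 0 ≤ Ψ S := fun S => Finset.sum_nonneg fun v _ => ha v
  set g : Finset V → ℝ := fun S => max 0 (if (S ∩ K).card = 0 then 1 - B * Ψ S else
    if (S ∩ K).card = 1 then p - A * Ψ S else 0) with hgdef
  have hg0 : ∀ S, 0 ≤ g S := fun S => le_max_left _ _
  have hgB : ∀ S, (S ∩ K).card = 0 → 1 - B * Ψ S ≤ g S := fun S hS => by
    simp only [hgdef, hS, if_true]; exact le_max_right _ _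
  have hgA : ∀ S, (S ∩ K).card = 1 → p - A * Ψ S ≤ g S := fun S hS => by
    simp only [hgdef, hS, if_true, one_ne_zero, if_false]; exact le_max_right _ _
  -- invariances
  have hnK : ∀ S u v, v ∉ K → nextSet S u v ∩ K = S ∩ K := by
    intro S u v hv
    unfold nextSet
    split_ifs
    · rw [Finset.insert_inter_of_notMem hv]
    · ext y; simp only [Finset.mem_inter, Finset.mem_erase]
      constructor
      · rintro ⟨⟨_, h⟩, h'⟩; exact ⟨h, h'⟩
      · rintro ⟨h, h'⟩; exact ⟨⟨fun e => hv (e ▸ h'), h⟩, h'⟩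
  have hnΨ : ∀ S u v, v ∈ K → Ψ (nextSet S u v) = Ψ S := by
    intro S u v hv
    simp only [nextSet, hΨ]
    split_ifs
    · exact Finset.sum_insert_of_eq_zero_if_notMem fun _ => haK v hv
    · exact Finset.sum_erase _ (haK v hv)
  have haz : ∀ u, u = z → ∑ v, w u v * a v = 0 := by
    rintro u rfl
    refine Finset.sum_eq_zero fun v _ => ?_
    by_cases hv : v ∈ K
    · rw [haK v hv, mul_zero]
    · rw [hzK v hv, zero_mul]
  refine ext_ge_uniform hr hw0 hw1 g hg0 (by simp [hgdef, hΨ]) ?_ K p (fun x hx => ?_)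
  swap
  · refine le_trans ?_ (hgA {x} ?_)
    · simp [hΨ, haK x hx]
    · simp [Finset.singleton_inter_of_mem hx]
  intro S hS hpos
  have hlin := gen_linear hr hw0 a ha S
  by_cases c0 : (S ∩ K).card = 0
  · have hgS : g S = 1 - B * Ψ S := by
      have : 0 < max 0 (1 - B * Ψ S) := by simpa only [hgdef, c0, if_true] using hpos
      simp only [hgdef, c0, if_true]
      rcases max_choice 0 (1 - B * Ψ S) with h | h
      · rw [h] at this; exact absurd this (lt_irrefl _)
      · exact h
    have hSK : ∀ v ∈ S, v ∉ K := fun v hv hk => by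
      rw [Finset.card_eq_zero] at c0
      exact Finset.notMem_empty v (c0 ▸ Finset.mem_inter.2 ⟨hv, hk⟩)
    have hlow : -B * gen r w Ψ S - ∑ u, ∑ v, (if u = z then (if z ∈ S then r * w u v else 0) else 0)
        ≤ gen r w g S := by
      unfold gen
      rw [Finset.mul_sum, ← Finset.sum_sub_distrib]
      refine Finset.sum_le_sum fun u _ => ?_
      rw [Finset.mul_sum, ← Finset.sum_sub_distrib]
      refine Finset.sum_le_sum fun v _ => ?_
      by_cases hu : u = z
      · subst hu
        by_cases hv : v ∈ K
        · rw [hnΨ S u v hv]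
          by_cases huS : u ∈ S
          · simp only [huS, rate, if_true]
            have h5 : -1 ≤ g (nextSet S u v) - g S := by
              rw [hgS]; nlinarith [hg0 (nextSet S u v), hΨ0 S]
            have h6 := hw0 u v
            have h7 : 0 ≤ r * w u v := by positivity
            nlinarith
          · have : nextSet S u v = S := by
              simp only [nextSet, huS, if_false]
              exact Finset.erase_eq_of_notMem fun h => hSK v h hv
            rw [this]; simp [huS]
        · simp [hzK v hv]
      · by_cases hv : v ∈ K
        · simp [hK u hu v hv]
        · have h5 := hgB (nextSet S u v) (by rw [hnK S u v hv]; exact c0)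
          simp only [hu, if_false, sub_zero]
          have h7 : 0 ≤ rate r S u * w u v := mul_nonneg (rate_pos hr S u).le (hw0 u v)
          have h8 : -B * (Ψ (nextSet S u v) - Ψ S) ≤ g (nextSet S u v) - g S := by
            rw [hgS]; linarith
          have := mul_le_mul_of_nonneg_left h8 h7
          linarith
    refine lt_of_lt_of_le ?_ hlow
    have hsum : ∑ u, ∑ v, (if u = z then (if z ∈ S then r * w u v else 0) else 0)
        = ∑ u ∈ S, if u = z then r else 0 := by
      rw [Finset.sum_comm]
      simp only [Finset.sum_ite_eq', Finset.mem_univ, if_true]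
      split_ifs
      · rw [← Finset.mul_sum, hw1, mul_one]
      · simp
    rw [hsum]
    have h9 := mul_le_mul_of_nonneg_left hlin hB.le
    have h10 : 0 < ∑ u ∈ S, (-B * (r * ∑ v, w u v * a v - (∑ v, w v u) * a u)
        - if u = z then r else 0) := by
      refine Finset.sum_pos (fun u hu => ?_) (Finset.nonempty_iff_ne_empty.2 hS)
      by_cases huz : u = z
      · rw [haz u huz]; subst huz
        simp only [if_true, hd]
        linarith
      · simp only [huz, if_false]
        nlinarith [h1 u (hSK u hu) huz]
    rw [Finset.sum_sub_distrib, ← Finset.mul_sum] at h10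
    linarith
  · by_cases c1 : (S ∩ K).card = 1
    swap
    · simp only [hgdef, c0, c1, if_false, max_self] at hpos
      exact absurd hpos (lt_irrefl _)
    have hgS : g S = p - A * Ψ S := by
      have : 0 < max 0 (p - A * Ψ S) := by
        simpa only [hgdef, c1, one_ne_zero, if_true, if_false] using hpos
      simp only [hgdef, c1, one_ne_zero, if_true, if_false]
      rcases max_choice 0 (p - A * Ψ S) with h | h
      · rw [h] at this; exact absurd this (lt_irrefl _)
      · exact h
    have hBΨ : B * Ψ S ≤ 1 / 2 := by
      rw [hgS, hAB] at hpos
      by_contra h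
      push Not at h
      nlinarith
    obtain ⟨x, hx⟩ := Finset.card_eq_one.1 c1
    have hxm : x ∈ S ∧ x ∈ K := by
      have : x ∈ S ∩ K := by rw [hx]; simp
      exact Finset.mem_inter.1 this
    have hSx : ∀ v ∈ S, v ∈ K → v = x := fun v hv hk => by
      have : v ∈ S ∩ K := Finset.mem_inter.2 ⟨hv, hk⟩
      rw [hx] at this; simpa using this
    have hlow : -A * gen r w Ψ S + ∑ u, ∑ v, (if u = z then (if z ∈ S then -(r * p) * w u v else
          if v = x then (1 / 2 - p) * w u v else 0) else 0)
        ≤ gen r w g S := by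
      unfold gen
      rw [Finset.mul_sum, ← Finset.sum_add_distrib]
      refine Finset.sum_le_sum fun u _ => ?_
      rw [Finset.mul_sum, ← Finset.sum_add_distrib]
      refine Finset.sum_le_sum fun v _ => ?_
      by_cases hu : u = z
      · subst hu
        by_cases hv : v ∈ K
        · rw [hnΨ S u v hv]
          by_cases huS : u ∈ S
          · simp only [huS, rate, if_true]
            have h5 : -p ≤ g (nextSet S u v) - g S := by
              rw [hgS]; nlinarith [hg0 (nextSet S u v), hΨ0 S]
            have h6 := hw0 u v
            have h7 : 0 ≤ r * w u v := by positivity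
            nlinarith
          · by_cases hvx : v = x
            · have h5 : (nextSet S u v ∩ K).card = 0 := by
                rw [Finset.card_eq_zero, Finset.eq_empty_iff_forall_notMem]
                intro y hy
                simp only [nextSet, huS, if_false, Finset.mem_inter, Finset.mem_erase] at hy
                exact hy.1.1 (hvx ▸ hSx y hy.1.2 hy.2)
              have h6 := hgB _ h5
              rw [hnΨ S u v hv] at h6
              simp only [huS, hvx, rate, if_true, if_false]
              rw [hvx] at h6
              have h8 : 1 / 2 - p ≤ g (nextSet S u x) - g S := by
                rw [hgS]; nlinarith [hΨ0 S]
              have := mul_le_mul_of_nonneg_left h8 (hw0 u x)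
              linarith
            · have : nextSet S u v = S := by
                simp only [nextSet, huS, if_false]
                exact Finset.erase_eq_of_notMem fun h => hvx (hSx v h hv)
              rw [this]; simp [huS, hvx]
        · simp [hzK v hv]
      · by_cases hv : v ∈ K
        · simp [hK u hu v hv, hu]
        · have h5 := hgA (nextSet S u v) (by rw [hnK S u v hv]; exact c1)
          simp only [hu, if_false, add_zero]
          have h7 : 0 ≤ rate r S u * w u v := mul_nonneg (rate_pos hr S u).le (hw0 u v)
          have h8 : -A * (Ψ (nextSet S u v) - Ψ S) ≤ g (nextSet S u v) - g S := by
            rw [hgS]; linarith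
          have := mul_le_mul_of_nonneg_left h8 h7
          linarith
    refine lt_of_lt_of_le ?_ hlow
    have hsum : ∑ u, ∑ v, (if u = z then (if z ∈ S then -(r * p) * w u v else
          if v = x then (1 / 2 - p) * w u v else 0) else 0)
        = if z ∈ S then -(r * p) else (1 / 2 - p) * δ := by
      rw [Finset.sum_comm]
      simp only [Finset.sum_ite_eq', Finset.mem_univ, if_true]
      split_ifs
      · rw [← Finset.mul_sum, hw1, mul_one]
      · simp only [Finset.sum_ite_eq', Finset.mem_univ, if_true, hδ x hxm.2]
    rw [hsum]
    have h9 := mul_le_mul_of_nonneg_left hlin hA.le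
    have h10 : ∑ u ∈ S, (r * ∑ v, w u v * a v - (∑ v, w v u) * a u) ≤
        q - if z ∈ S then d else 0 := by
      have h11 : ∑ u ∈ S, (r * ∑ v, w u v * a v - (∑ v, w v u) * a u) ≤
          ∑ u ∈ S, ((if u = x then q else 0) - if u = z then d else 0) := by
        refine Finset.sum_le_sum fun u hu => ?_
        by_cases hux : u = x
        · have hxz : u ≠ z := fun h => hz (h ▸ hux ▸ hxm.2)
          have := hq u (hux ▸ hxm.2)
          rw [haK u (hux ▸ hxm.2)]
          simp only [hux, if_true]
          rw [if_neg (hux ▸ hxz)]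
          rw [hux] at this
          linarith
        · by_cases huz : u = z
          · rw [haz u huz]; subst huz
            simp only [hux, if_true, if_false, hd]
            linarith
          · simp only [hux, huz, if_false]
            have := h1 u (fun h => hux (hSx u hu h)) huz
            linarith
      refine h11.trans (le_of_eq ?_)
      rw [Finset.sum_sub_distrib]
      simp [hxm.1]
    have h12 := mul_le_mul_of_nonneg_left h10 hA.le
    change A * gen r w Ψ S ≤ _ at h9
    split_ifs at h12 ⊢
    · linarith
    · linarith

end abstractPart

section metafunnelPart

lemma ow_sum {V : Type*} [Fintype V] [DecidableEq V] (out : V → Finset V) (u : V)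
    (hne : (out u).Nonempty) (a : V → ℝ) (α : ℝ) (ha : ∀ v ∈ out u, a v = α) :
    ∑ v, outWeights out u v * a v = α := by
  unfold outWeights
  simp only [ite_mul, zero_mul]
  rw [Finset.sum_ite_mem, Finset.univ_inter]
  rw [Finset.sum_congr rfl (fun v hv => by rw [ha v hv]), Finset.sum_const, nsmul_eq_mul]
  have : ((out u).card : ℝ) ≠ 0 := by exact_mod_cast hne.card_pos.ne'
  field_simp

lemma ow_nonneg {V : Type*} [DecidableEq V] (out : V → Finset V) (u v : V) :
    0 ≤ outWeights out u v := by
  unfold outWeights; split_ifs <;> positivity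

lemma ow_in_ge {V : Type*} [Fintype V] [DecidableEq V] (out : V → Finset V) (x : V)
    (I : Finset V) (c : ℕ) (hI : ∀ u ∈ I, x ∈ out u) (hc : ∀ u ∈ I, (out u).card = c) :
    (I.card : ℝ) * (c : ℝ)⁻¹ ≤ ∑ u, outWeights out u x := by
  calc (I.card : ℝ) * (c : ℝ)⁻¹ = ∑ u ∈ I, outWeights out u x := by
        rw [← nsmul_eq_mul, ← Finset.sum_const]
        refine Finset.sum_congr rfl fun u hu => ?_
        simp [outWeights, hI u hu, hc u hu]
    _ ≤ _ := Finset.sum_le_sum_of_subset_of_nonneg (Finset.subset_univ _)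
          fun u _ _ => ow_nonneg _ _ _

variable {k ℓ m : ℕ}

lemma lev_inl (u : Unit) : mfLevel (Sum.inl u : MetafunnelV k ℓ m) = 0 := rfl

lemma lev_inr (i : Fin k) (x : Fin ℓ × Fin (m ^ ((i : ℕ) + 1))) :
    mfLevel (Sum.inr ⟨i, x⟩ : MetafunnelV k ℓ m) = (i : ℕ) + 1 := rfl

lemma cop_inr (i : Fin k) (j : Fin ℓ) (x : Fin (m ^ ((i : ℕ) + 1))) :
    mfCopy (Sum.inr ⟨i, j, x⟩ : MetafunnelV k ℓ m) = some j := rfl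

lemma card_levelCopy (i : Fin k) (j : Fin ℓ) :
    (Finset.univ.filter fun v : MetafunnelV k ℓ m =>
      mfLevel v = (i : ℕ) + 1 ∧ mfCopy v = some j).card = m ^ ((i : ℕ) + 1) := by
  have h : (Finset.univ.filter fun v : MetafunnelV k ℓ m =>
      mfLevel v = (i : ℕ) + 1 ∧ mfCopy v = some j)
      = Finset.univ.image (fun x : Fin (m ^ ((i : ℕ) + 1)) =>
          (Sum.inr ⟨i, j, x⟩ : MetafunnelV k ℓ m)) := by
    ext v
    rcases v with u | ⟨i', j', x⟩
    · simp [lev_inl, lev_inr]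
    · simp only [lev_inl, lev_inr, cop_inr, Finset.mem_filter, Finset.mem_univ, true_and,
        Finset.mem_image, Option.some.injEq]
      constructor
      · rintro ⟨h1, rfl⟩
        have : i' = i := Fin.ext (by omega)
        subst this
        exact ⟨x, rfl⟩
      · rintro ⟨y, hy⟩
        have hy := Sum.inr.inj hy
        cases hy
        exact ⟨rfl, rfl⟩
  rw [h, Finset.card_image_of_injective]
  · simp
  · intro x y hxy
    simpa using hxy

lemma card_level (i : Fin k) :
    (Finset.univ.filter fun v : MetafunnelV k ℓ m =>
      mfLevel v = (i : ℕ) + 1).card = ℓ * m ^ ((i : ℕ) + 1) := by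
  have h : (Finset.univ.filter fun v : MetafunnelV k ℓ m =>
      mfLevel v = (i : ℕ) + 1)
      = Finset.univ.image (fun x : Fin ℓ × Fin (m ^ ((i : ℕ) + 1)) =>
          (Sum.inr ⟨i, x⟩ : MetafunnelV k ℓ m)) := by
    ext v
    rcases v with u | ⟨i', j', x⟩
    · simp [lev_inl, lev_inr]
    · simp only [lev_inl, lev_inr, Finset.mem_filter, Finset.mem_univ, true_and,
        Finset.mem_image]
      constructor
      · intro h1
        have : i' = i := Fin.ext (by omega)
        subst this
        exact ⟨(j', x), rfl⟩
      · rintro ⟨y, hy⟩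
        have hy := Sum.inr.inj hy
        cases hy
        rfl
  rw [h, Finset.card_image_of_injective]
  · simp
  · intro x y hxy
    simpa using hxy

lemma card_metafunnel (k ℓ m : ℕ) :
    Fintype.card (MetafunnelV k ℓ m) = 1 + ℓ * ∑ i ∈ Finset.range k, m ^ (i + 1) := by
  simp only [MetafunnelV, Fintype.card_sum, Fintype.card_unit, Fintype.card_sigma,
    Fintype.card_prod, Fintype.card_fin]
  rw [Finset.mul_sum, Fin.sum_univ_eq_sum_range (fun i => ℓ * m ^ (i + 1))]

lemma level_of_out (i : Fin k) (x : Fin ℓ × Fin (m ^ ((i : ℕ) + 1)))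
    (v : MetafunnelV k ℓ m) (hv : v ∈ metafunnelOut k ℓ m (Sum.inr ⟨i, x⟩)) :
    mfLevel v = i := by
  obtain ⟨j, x⟩ := x
  simp only [metafunnelOut] at hv
  split_ifs at hv with h
  · rw [Finset.mem_singleton] at hv
    subst hv; simp [lev_inl, lev_inr, h]
  · exact (Finset.mem_filter.1 hv).2.1

lemma card_out (hm : 0 < m) (i : Fin k) (x : Fin ℓ × Fin (m ^ ((i : ℕ) + 1))) :
    (metafunnelOut k ℓ m (Sum.inr ⟨i, x⟩)).card = m ^ (i : ℕ) := by
  obtain ⟨j, x⟩ := x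
  simp only [metafunnelOut]
  split_ifs with h
  · simp [h]
  · obtain ⟨i, hi⟩ := i
    cases i with
    | zero => simp at h
    | succ i => exact card_levelCopy (m := m) ⟨i, by omega⟩ j

lemma out_nonempty (hk : 0 < k) (hl : 0 < ℓ) (hm : 0 < m) (u : MetafunnelV k ℓ m) :
    (metafunnelOut k ℓ m u).Nonempty := by
  rw [← Finset.card_pos]
  rcases u with u | ⟨i, x⟩
  · obtain ⟨k, rfl⟩ : ∃ k', k = k' + 1 := ⟨k - 1, by omega⟩
    have := card_level (ℓ := ℓ) (m := m) (Fin.last k)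
    simp only [Fin.val_last] at this
    simp only [metafunnelOut]
    rw [this]; positivity
  · rw [card_out hm]; positivity

lemma ow_row (hk : 0 < k) (hl : 0 < ℓ) (hm : 0 < m) (u : MetafunnelV k ℓ m) :
    ∑ v, outWeights (metafunnelOut k ℓ m) u v = 1 := by
  have := ow_sum (metafunnelOut k ℓ m) u (out_nonempty hk hl hm u) (fun _ => 1) 1 (by simp)
  simpa using this

lemma ow_loop (hk : 0 < k) (u : MetafunnelV k ℓ m) :
    outWeights (metafunnelOut k ℓ m) u u = 0 := by
  unfold outWeights
  rw [if_neg]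
  intro h
  rcases u with u | ⟨i, x⟩
  · simp [metafunnelOut, lev_inl, lev_inr] at h; omega
  · have := level_of_out i x _ h
    simp [lev_inl, lev_inr] at this

/-- Temperature of non-top vertices. -/
lemma temp_center (hk : 0 < k) :
    (ℓ : ℝ) * m ≤ ∑ v, outWeights (metafunnelOut k ℓ m) v (Sum.inl ()) := by
  have h := ow_in_ge (metafunnelOut k ℓ m) (Sum.inl ())
    (Finset.univ.filter fun v : MetafunnelV k ℓ m => mfLevel v = 1) 1 ?_ ?_
  · have h2 := card_level (ℓ := ℓ) (m := m) (⟨0, hk⟩ : Fin k)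
    simp only [zero_add, pow_one] at h2
    rw [h2] at h
    simpa using h
  · rintro (u | ⟨i, j, x⟩) hu
    · simp [lev_inl, lev_inr] at hu
    · simp [lev_inl, lev_inr] at hu
      simp [metafunnelOut, hu]
  · rintro (u | ⟨i, j, x⟩) hu
    · simp [lev_inl, lev_inr] at hu
    · simp [lev_inl, lev_inr] at hu
      simp [metafunnelOut, hu]

lemma temp_mid (hm : 0 < m) (i : Fin k) (hi : (i : ℕ) + 1 < k)
    (x : Fin ℓ × Fin (m ^ ((i : ℕ) + 1))) :
    (m : ℝ) ≤ ∑ v, outWeights (metafunnelOut k ℓ m) v (Sum.inr ⟨i, x⟩) := by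
  obtain ⟨j, x⟩ := x
  have h := ow_in_ge (metafunnelOut k ℓ m) (Sum.inr ⟨i, j, x⟩)
    (Finset.univ.filter fun v : MetafunnelV k ℓ m =>
      mfLevel v = (i : ℕ) + 1 + 1 ∧ mfCopy v = some j) (m ^ ((i : ℕ) + 1)) ?_ ?_
  · have h2 := card_levelCopy (m := m) (⟨i + 1, hi⟩ : Fin k) j
    simp only at h2
    rw [h2] at h
    refine le_trans (le_of_eq ?_) h
    have : (m : ℝ) ≠ 0 := by exact_mod_cast hm.ne'
    push_cast
    field_simp
    ring
  · rintro (u | ⟨i', j', x'⟩) hu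
    · simp [lev_inl, lev_inr] at hu
    · simp [lev_inl, lev_inr, cop_inr] at hu
      simp [metafunnelOut, hu, lev_inl, lev_inr, cop_inr]
  · rintro (u | ⟨i', j', x'⟩) hu
    · simp [lev_inl, lev_inr] at hu
    · simp [lev_inl, lev_inr] at hu
      rw [card_out hm, hu.1]

/-- Start outside the top level. -/
lemma ext_low {r : ℝ} (hr : 1 < r) (hk : 0 < k) (hl : 0 < ℓ) (hm : 0 < m)
    (X : Finset (MetafunnelV k ℓ m)) (hX : ∀ x ∈ X, mfLevel x ≠ k) :
    (X.card : ℝ) / (Fintype.card (MetafunnelV k ℓ m) : ℝ) * (1 / (2 + r)) ≤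
      extinctionProb r (outWeights (metafunnelOut k ℓ m))
            (uniformSingleton (MetafunnelV k ℓ m)) := by
  have hm1 : (1 : ℝ) ≤ m := by exact_mod_cast hm
  have hl1 : (1 : ℝ) ≤ ℓ := by exact_mod_cast hl
  refine ext_singleton hr (ow_nonneg _) (ow_row hk hl hm) (ow_loop hk) X ?_
  rintro (u | ⟨i, x⟩) hx
  · refine le_trans ?_ (temp_center hk)
    nlinarith
  · refine hm1.trans (temp_mid hm i ?_ x)
    have := hX _ hx
    simp only [lev_inl, lev_inr] at this
    omega

lemma ext_top {r : ℝ} (hr : 1 < r) (k' : ℕ) (hl : 0 < ℓ) (hm : 0 < m)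
    (hbig : 4 * r ^ (k' + 1) ≤ ℓ * (m : ℝ) ^ (k' + 1)) :
    ((ℓ * m ^ (k' + 1) : ℕ) : ℝ) / (Fintype.card (MetafunnelV (k' + 1) ℓ m) : ℝ) *
        (1 / (32 * r ^ (k' + 2))) ≤
      extinctionProb r (outWeights (metafunnelOut (k' + 1) ℓ m))
            (uniformSingleton (MetafunnelV (k' + 1) ℓ m)) := by
  have hm1 : (1 : ℝ) ≤ m := by exact_mod_cast hm
  have hl1 : (1 : ℝ) ≤ ℓ := by exact_mod_cast hl
  have hm0 : (0 : ℝ) < m := by linarith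
  have hl0 : (0 : ℝ) < ℓ := by linarith
  have hr0 : 0 < r := by linarith
  set K : Finset (MetafunnelV (k' + 1) ℓ m) := Finset.univ.filter fun v => mfLevel v = k' + 1
    with hKdef
  have hKc : K.card = ℓ * m ^ (k' + 1) := by
    have := card_level (ℓ := ℓ) (m := m) (Fin.last k')
    simpa only [Fin.val_last] using this
  rw [← hKc]
  set c : ℕ → ℝ := fun i => r ^ i * (1 + i / (k' + 1)) / (m : ℝ) ^ i with hc
  have hc0 : ∀ i, 0 ≤ c i := fun i => by simp only [hc]; positivity
  set p : ℝ := 1 / (32 * r ^ (k' + 2)) with hp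
  have hp0 : 0 < p := by positivity
  have hpe : p * r ^ (k' + 2) = 1 / 32 := by rw [hp]; field_simp
  have hp1 : p ≤ 1 / 32 := by
    have h1 : 1 ≤ r ^ (k' + 2) := one_le_pow₀ hr.le
    nlinarith
  set a : MetafunnelV (k' + 1) ℓ m → ℝ := fun v => if mfLevel v = k' + 1 then 0
    else c (mfLevel v) with ha
  have hPa : ∀ (i : Fin (k' + 1)) (x : Fin ℓ × Fin (m ^ ((i : ℕ) + 1))),
      ∑ v, outWeights (metafunnelOut (k' + 1) ℓ m) (Sum.inr ⟨i, x⟩) v * a v = c i := by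
    intro i x
    refine ow_sum _ _ (out_nonempty (Nat.succ_pos _) hl hm _) a _ fun v hv => ?_
    have := level_of_out i x v hv
    simp only [ha, this]
    rw [if_neg (by omega)]
  refine ext_main hr (ow_nonneg _) (ow_row (Nat.succ_pos _) hl hm) K (Sum.inl ()) ?_ ?_ ?_
    a ?_ ?_ (2 * p * (2 * r / (ℓ * m))) (2 * r / (ℓ * m)) p _ (2 * r ^ (k' + 1) / (m : ℝ) ^ k')
    ((ℓ * (m : ℝ) ^ (k' + 1))⁻¹) (by positivity) hp0 (by linarith) rfl ?_ rfl ?_ ?_ ?_ ?_ ?_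
  · simp [hKdef, lev_inl, lev_inr]
  · intro v hv
    unfold outWeights
    rw [if_neg]
    simpa [hKdef, metafunnelOut] using hv
  · rintro (u | ⟨i, x⟩) hu v hv
    · exact absurd rfl hu
    · unfold outWeights
      rw [if_neg]
      intro h
      have := level_of_out i x v h
      simp [hKdef] at hv
      omega
  · intro v; simp only [ha]; split_ifs
    · exact le_rfl
    · exact hc0 _
  · intro v hv
    simp [hKdef] at hv
    simp [ha, hv]
  · rintro (u | ⟨i, x⟩) hu hz
    · exact absurd rfl hz
    · simp only [hKdef, Finset.mem_filter, Finset.mem_univ, true_and, lev_inl, lev_inr] at hu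
      rw [hPa]
      have h1 := temp_mid hm i (by omega) x
      have h2 : a (Sum.inr ⟨i, x⟩) = c (i + 1) := by
        simp only [ha, lev_inl, lev_inr, hu, if_false]
      rw [h2]
      refine lt_of_lt_of_le ?_ (mul_le_mul_of_nonneg_right h1 (hc0 _))
      have h3 : (m : ℝ) * c (i + 1) - r * c i = r ^ ((i : ℕ) + 1) / (m : ℝ) ^ (i : ℕ) / (k' + 1) := by
        simp only [hc]; push_cast
        field_simp
        ring
      have h4 : 0 < r ^ ((i : ℕ) + 1) / (m : ℝ) ^ (i : ℕ) / ((k' : ℝ) + 1) := by positivity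
      linarith
  · rintro (u | ⟨i, x⟩) hu
    · simp [hKdef, lev_inl, lev_inr] at hu
    · simp only [hKdef, Finset.mem_filter, Finset.mem_univ, true_and, lev_inl, lev_inr] at hu
      rw [hPa]
      have hik : (i : ℕ) = k' := by omega
      rw [hik]
      simp only [hc]
      have h1 : (k' : ℝ) / (k' + 1) ≤ 1 := by
        rw [div_le_one (by positivity)]; linarith
      rw [← mul_div_assoc]
      apply div_le_div_of_nonneg_right _ (by positivity)
      have h2 : 0 < r ^ (k' + 1) := by positivity
      calc r * (r ^ k' * (1 + k' / (k' + 1))) = r ^ (k' + 1) * (1 + k' / (k' + 1)) := by ring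
        _ ≤ _ := by nlinarith
  · intro u hu
    have h1 : metafunnelOut (k' + 1) ℓ m (Sum.inl ()) = K := rfl
    unfold outWeights
    rw [h1, if_pos hu, hKc]
    push_cast; rfl
  · have h1 : a (Sum.inl ()) = 1 := by simp [ha, lev_inl, lev_inr, hc]
    rw [h1, mul_one]
    have h2 := temp_center (k := k' + 1) (ℓ := ℓ) (m := m) (Nat.succ_pos _)
    have h3 : 2 * r / (ℓ * m) * (ℓ * m) = 2 * r := by field_simp
    have h4 := mul_le_mul_of_nonneg_left h2 (show 0 ≤ 2 * r / (ℓ * m) by positivity)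
    linarith
  · have h1 : 2 * p * (2 * r / (ℓ * m)) * (2 * r ^ (k' + 1) / (m : ℝ) ^ k')
        = 8 * (p * r ^ (k' + 2)) * (ℓ * (m : ℝ) ^ (k' + 1))⁻¹ := by
      field_simp; ring
    rw [h1, hpe]
    apply mul_lt_mul_of_pos_right _ (by positivity)
    linarith
  · have h1 : a (Sum.inl ()) = 1 := by simp [ha, lev_inl, lev_inr, hc]
    rw [h1, mul_one]
    have h2 := temp_center (k := k' + 1) (ℓ := ℓ) (m := m) (Nat.succ_pos _)
    have h3 : 2 * p * (2 * r / (ℓ * m)) * (ℓ * m) = 4 * p * r := by field_simp; ring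
    have h4 := mul_le_mul_of_nonneg_left h2 (show 0 ≤ 2 * p * (2 * r / (ℓ * m)) by positivity)
    have h5 : 2 * p * (2 * r / (ℓ * m)) * (2 * r ^ (k' + 1) / (m : ℝ) ^ k')
        = 2 * p * r * (4 * r ^ (k' + 1) / (ℓ * (m : ℝ) ^ (k' + 1))) := by
      field_simp; ring
    have h6 : 4 * r ^ (k' + 1) / (ℓ * (m : ℝ) ^ (k' + 1)) ≤ 1 := by
      rw [div_le_one (by positivity)]; exact hbig
    have h7 : 0 < p * r := by positivity
    nlinarith

end metafunnelPart

/-- The bound with a constant factor. -/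
lemma ext_const {r : ℝ} (hr : 1 < r) (k ℓ m : ℕ) (hk : 0 < k) (hl : 0 < ℓ) (hm : 0 < m)
    (n : ℕ) (hn : n = Fintype.card (MetafunnelV k ℓ m)) (hn3 : 3 ≤ n) :
    Real.exp (-Real.sqrt (Real.log r * Real.log (n : ℝ))) * (1 / (144 * r * (2 + r))) ≤
      extinctionProb r (outWeights (metafunnelOut k ℓ m))
            (uniformSingleton (MetafunnelV k ℓ m)) := by
  have hr0 : 0 < r := by linarith
  have hn3' : (3 : ℝ) ≤ n := by exact_mod_cast hn3
  have hn0 : (0 : ℝ) < n := by linarith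
  have hlr : 0 < Real.log r := Real.log_pos hr
  have hL : 0 < Real.log n := Real.log_pos (by linarith)
  set s := Real.sqrt (Real.log r * Real.log (n : ℝ)) with hs
  have hs0 : 0 ≤ s := Real.sqrt_nonneg _
  have hss : s * s = Real.log r * Real.log n := Real.mul_self_sqrt (by positivity)
  have he1 : Real.exp (-s) ≤ 1 := Real.exp_le_one_iff.2 (by linarith)
  have he0 : 0 < Real.exp (-s) := Real.exp_pos _
  obtain ⟨k, rfl⟩ : ∃ k', k = k' + 1 := ⟨k - 1, by omega⟩
  have hcard := card_metafunnel (k + 1) ℓ m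
  rw [← hn, Finset.sum_range_succ] at hcard
  -- small n
  by_cases hsmall : (n : ℝ) ≤ 144 * r
  · have h := ext_low (k := k + 1) hr hk hl hm {Sum.inl ()} (by simp [lev_inl, lev_inr])
    refine le_trans ?_ h
    rw [← hn, Finset.card_singleton]
    calc Real.exp (-s) * (1 / (144 * r * (2 + r))) ≤ 1 * (1 / (144 * r * (2 + r))) :=
          mul_le_mul_of_nonneg_right he1 (by positivity)
      _ = 1 / (144 * r) * (1 / (2 + r)) := by field_simp
      _ ≤ _ := by
        refine mul_le_mul_of_nonneg_right ?_ (by positivity)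
        push_cast
        exact one_div_le_one_div_of_le hn0 hsmall
  push Not at hsmall
  by_cases hcase : 1 ≤ k ∧ (m = 1 ∨ s < (k + 1) * Real.log r)
  · obtain ⟨hk1, hc⟩ := hcase
    -- m ≤ exp s
    have hm1 : (1 : ℝ) ≤ m := by exact_mod_cast hm
    have hms : (m : ℝ) ≤ Real.exp s := by
      rcases hc with h | h
      · rw [h]; simpa using hs0
      · have h1 : m ^ (k + 1) ≤ n := by rw [hcard]; nlinarith [Nat.zero_le (ℓ * ∑ x ∈ Finset.range k, m ^ (x + 1)), Nat.zero_le (m ^ (k + 1))]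
        have h2 : (m : ℝ) ^ (k + 1) ≤ n := by exact_mod_cast h1
        have h3 := Real.log_le_log (by positivity) h2
        rw [Real.log_pow] at h3
        push_cast at h3
        rw [← Real.log_le_iff_le_exp (by linarith)]
        by_contra h4
        push Not at h4
        have h5 : ((k : ℝ) + 1) * s < Real.log n := by
          have : (0 : ℝ) < k + 1 := by positivity
          nlinarith
        have h6 : Real.log r * (((k : ℝ) + 1) * s) < s * s := by
          rw [hss]; exact mul_lt_mul_of_pos_left h5 hlr
        nlinarith
    set X : Finset (MetafunnelV (k + 1) ℓ m) := Finset.univ.filter fun v => mfLevel v ≠ k + 1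
      with hX
    have h := ext_low (k := k + 1) hr hk hl hm X (by simp [hX])
    refine le_trans ?_ h
    rw [← hn]
    have hXc : X.card + ℓ * m ^ (k + 1) = n := by
      have h1 := card_level (ℓ := ℓ) (m := m) (Fin.last k)
      simp only [Fin.val_last] at h1
      rw [← h1, hn, ← Finset.card_univ, hX, add_comm]
      exact Finset.card_filter_add_card_filter_not _
    have hXge : ℓ * m ^ k ≤ X.card := by
      obtain ⟨k, rfl⟩ : ∃ k', k = k' + 1 := ⟨k - 1, by omega⟩
      rw [Finset.sum_range_succ] at hcard
      nlinarith [Nat.zero_le (ℓ * ∑ x ∈ Finset.range k, m ^ (x + 1))]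
    have hn2 : n ≤ 2 * m * X.card := by
      rw [pow_succ] at hXc
      nlinarith
    have hn2' : (n : ℝ) ≤ 2 * m * X.card := by exact_mod_cast hn2
    have h5 : Real.exp (-s) * (1 / 2) ≤ (X.card : ℝ) / n := by
      rw [le_div_iff₀ hn0, Real.exp_neg]
      have h6 : (0 : ℝ) ≤ X.card := by positivity
      have h7 : (n : ℝ) ≤ 2 * Real.exp s * X.card := by nlinarith
      have h8 : 0 < Real.exp s := Real.exp_pos s
      calc (Real.exp s)⁻¹ * (1 / 2) * n ≤ (Real.exp s)⁻¹ * (1 / 2) * (2 * Real.exp s * X.card) :=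
            mul_le_mul_of_nonneg_left h7 (by positivity)
        _ = X.card := by field_simp
    calc Real.exp (-s) * (1 / (144 * r * (2 + r)))
        = Real.exp (-s) * (1 / (144 * r)) * (1 / (2 + r)) := by field_simp
      _ ≤ Real.exp (-s) * (1 / 2) * (1 / (2 + r)) := by
        gcongr; linarith
      _ ≤ _ := mul_le_mul_of_nonneg_right h5 (by positivity)
  · -- start at the top
    have hks : (k + 1) * Real.log r ≤ s := by
      by_contra h
      push Not at h
      have hk0 : k = 0 := by
        by_contra h0
        exact hcase ⟨by omega, Or.inr h⟩
      subst hk0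
      simp only [Nat.cast_zero, zero_add, one_mul] at h
      have h1 : Real.log n < Real.log r := by
        by_contra h2
        push Not at h2
        nlinarith
      have := (Real.log_lt_log_iff hn0 hr0).1 h1
      linarith
    have hrk : r ^ (k + 1) ≤ Real.exp s := by
      have h1 : r ^ (k + 1) = Real.exp ((k + 1) * Real.log r) := by
        rw [← Real.exp_log (pow_pos hr0 (k + 1)), Real.log_pow]
        push_cast; rfl
      rw [h1]; exact Real.exp_le_exp.2 hks
    have htop : n ≤ 3 * (ℓ * m ^ (k + 1)) := by
      have h1 : 1 ≤ ℓ * m ^ (k + 1) := Nat.succ_le_of_lt (by positivity)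
      have h2 : ∑ x ∈ Finset.range k, m ^ (x + 1) ≤ m ^ (k + 1) := by
        rcases Nat.eq_zero_or_pos k with h0 | h0
        · subst h0; simp
        · have hm2 : 2 ≤ m := by
            by_contra h3
            exact hcase ⟨h0, Or.inl (by omega)⟩
          clear hcase hcard hks hrk hn hk h0 h1
          induction k with
          | zero => simp
          | succ k ih =>
            rw [Finset.sum_range_succ, pow_succ m (k + 1)]
            have := Nat.mul_le_mul_left (m ^ (k + 1)) hm2
            omega
      have h3 := Nat.mul_le_mul_left ℓ h2
      rw [hcard, mul_add]
      omega
    have htop' : (n : ℝ) ≤ 3 * (ℓ * (m : ℝ) ^ (k + 1)) := by exact_mod_cast htop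
    have hbig : 12 * Real.exp s ≤ n := by
      by_contra h
      push Not at h
      have h1 : Real.log n < Real.log 12 + s := by
        rw [← Real.log_exp s, ← Real.log_mul (by norm_num) (Real.exp_pos s).ne']
        exact Real.log_lt_log hn0 h
      have h2 : 2 * s ≤ Real.log r + Real.log n := by
        nlinarith [sq_nonneg (Real.log r - Real.log n)]
      have h3 : Real.log n < Real.log (144 * r) := by
        rw [Real.log_mul (by norm_num) hr0.ne', show (144 : ℝ) = 12 * 12 by norm_num,
          Real.log_mul (by norm_num) (by norm_num)]
        linarith
      have := (Real.log_lt_log_iff hn0 (by positivity)).1 h3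
      linarith
    have h := ext_top hr k hl hm (by linarith)
    refine le_trans ?_ h
    rw [← hn]
    have h5 : (1 / 3 : ℝ) ≤ ((ℓ * m ^ (k + 1) : ℕ) : ℝ) / n := by
      rw [le_div_iff₀ hn0]; push_cast; linarith
    have h6 : Real.exp (-s) * (1 / (32 * r)) ≤ 1 / (32 * r ^ (k + 2)) := by
      rw [Real.exp_neg, show (32 * r ^ (k + 2)) = r ^ (k + 1) * (32 * r) by ring,
        one_div (r ^ (k + 1) * (32 * r)), mul_inv, ← one_div (32 * r)]
      refine mul_le_mul_of_nonneg_right ?_ (by positivity)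
      exact inv_anti₀ (by positivity) hrk
    calc Real.exp (-s) * (1 / (144 * r * (2 + r)))
        ≤ Real.exp (-s) * (1 / (96 * r)) := by
          refine mul_le_mul_of_nonneg_left ?_ he0.le
          apply one_div_le_one_div_of_le (by positivity)
          nlinarith
      _ = 1 / 3 * (Real.exp (-s) * (1 / (32 * r))) := by field_simp; norm_num
      _ ≤ _ := mul_le_mul h5 h6 (by positivity) (by positivity)

/-- **Extinction lower bound for metafunnels** (Theorem 5.1).  For every `r > 1` there
is a constant `c > 0` such that for all positive integers `k`, `ℓ`, `m` for which the
`(k,ℓ,m)`-metafunnel has `n ≥ 3` vertices, the discrete-time Moran process with fitness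
`r` on the `(k,ℓ,m)`-metafunnel, started from a single initial mutant at a uniformly
random vertex, has extinction probability at least
`e^{-√(log r · log n)} · (log n)^{-c}`. -/
theorem metafunnel_extinction_lower_bound (r : ℝ) (hr : 1 < r) :
    ∃ c : ℝ, 0 < c ∧ ∀ k ℓ m : ℕ, 0 < k → 0 < ℓ → 0 < m →
      ∀ n : ℕ, n = Fintype.card (MetafunnelV k ℓ m) → 3 ≤ n →
        Real.exp (-Real.sqrt (Real.log r * Real.log (n : ℝ))) *
            Real.log (n : ℝ) ^ (-c) ≤
          extinctionProb r (outWeights (metafunnelOut k ℓ m))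
            (uniformSingleton (MetafunnelV k ℓ m)) := by
  have hr0 : 0 < r := by linarith
  set C : ℝ := 1 / (144 * r * (2 + r)) with hC
  have hC0 : 0 < C := by positivity
  have hC1 : C < 1 := by
    rw [hC, div_lt_one (by positivity)]
    nlinarith
  have h3 : 1 < Real.log 3 := by
    rw [Real.lt_log_iff_exp_lt (by norm_num)]
    linarith [Real.exp_one_lt_d9]
  have hll : 0 < Real.log (Real.log 3) := Real.log_pos h3
  have hlC : Real.log C < 0 := Real.log_neg hC0 hC1
  refine ⟨-Real.log C / Real.log (Real.log 3), div_pos (by linarith) hll, ?_⟩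
  intro k ℓ m hk hl hm n hn hn3
  refine le_trans ?_ (ext_const hr k ℓ m hk hl hm n hn hn3)
  refine mul_le_mul_of_nonneg_left ?_ (Real.exp_pos _).le
  rw [← hC]
  have hn3' : (3 : ℝ) ≤ n := by exact_mod_cast hn3
  have hlog : Real.log 3 ≤ Real.log n := Real.log_le_log (by norm_num) hn3'
  have hLpos : 0 < Real.log n := by linarith
  have hll2 : Real.log (Real.log 3) ≤ Real.log (Real.log n) :=
    Real.log_le_log (by linarith) hlog
  rw [Real.rpow_def_of_pos hLpos, ← Real.le_log_iff_exp_le hC0]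
  have h5 : Real.log (Real.log n) / Real.log (Real.log 3) ≥ 1 := (one_le_div hll).2 hll2
  have h6 : Real.log (Real.log n) * -(-Real.log C / Real.log (Real.log 3))
      = Real.log (Real.log n) / Real.log (Real.log 3) * Real.log C := by
    field_simp
  rw [h6]
  nlinarith
end

section
/- Let r > 1 and let k, ℓ, m be arbitrary positive integers; let n = 1+ℓ(m+1+k). The discrete-time Moran process with fitness r on the (k,ℓ,m)-megastar, started from a single initial mutant placed at a uniformly random vertex, has fixation probability at most 1 − 1/(52·r²·√n). -/
open Finset

/-- Vertices of the `(k,ℓ,m)`-megastar: `ℓ` reservoirs `R_i` of size `m`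
(`Sum.inl (i, x)`), `ℓ` feeder vertices `a_i` (`Sum.inr (Sum.inl i)`), `ℓ` cliques `K_i`
of size `k` (`Sum.inr (Sum.inr (Sum.inl (i, x)))`), and the centre vertex `v*`
(`Sum.inr (Sum.inr (Sum.inr ()))`).  It has `1 + ℓ * (m + 1 + k)` vertices. -/
abbrev MegastarV (k ℓ m : ℕ) : Type :=
  (Fin ℓ × Fin m) ⊕ (Fin ℓ ⊕ ((Fin ℓ × Fin k) ⊕ Unit))

/-- Out-neighbourhoods of the `(k,ℓ,m)`-megastar: the centre points to every reservoir
vertex, each vertex of `R_i` points to `a_i`, each `a_i` points to every vertex of `K_i`,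
the vertices within each clique `K_i` are pairwise connected in both directions, and every
clique vertex points to the centre. -/
def megastarOut (k ℓ m : ℕ) : MegastarV k ℓ m → Finset (MegastarV k ℓ m)
  | Sum.inl (i, _) => {Sum.inr (Sum.inl i)}
  | Sum.inr (Sum.inl i) =>
      (Finset.univ : Finset (Fin k)).image fun x => Sum.inr (Sum.inr (Sum.inl (i, x)))
  | Sum.inr (Sum.inr (Sum.inl (i, x))) =>
      (((Finset.univ : Finset (Fin k)).erase x).image
          fun y => Sum.inr (Sum.inr (Sum.inl (i, y)))) ∪
        {Sum.inr (Sum.inr (Sum.inr ()))}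
  | Sum.inr (Sum.inr (Sum.inr _)) =>
      (Finset.univ : Finset (Fin ℓ × Fin m)).image fun p => Sum.inl p


namespace MegaAux

variable {V : Type*} [Fintype V] [DecidableEq V]

/-- The mutant set after `u` reproduces onto `v`. -/
def upd (S : Finset V) (u v : V) : Finset V := if u ∈ S then insert v S else S.erase v

/-- The fitness of `u`. -/
noncomputable def rate (r : ℝ) (S : Finset V) (u : V) : ℝ := if u ∈ S then r else 1

lemma rate_sum (r : ℝ) (S : Finset V) : ∑ u : V, rate r S u = moranW r S := by
  unfold rate moranW
  rw [Finset.sum_ite]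
  simp only [Finset.sum_const, nsmul_eq_mul, mul_one]
  have h1 : (Finset.univ.filter (fun x => x ∈ S)) = S := by ext; simp
  have h2 : (Finset.univ.filter (fun x => x ∉ S)) = Sᶜ := by ext; simp
  rw [h1, h2, Finset.card_compl, Nat.cast_sub (Finset.card_le_univ S)]
  ring

lemma step_apply (r : ℝ) (w : V → V → ℝ) (S : Finset V) (g : Finset V → ℝ) :
    ∑ T, moranStep r w S T * g T
      = (∑ u : V, ∑ v : V, rate r S u * w u v * g (upd S u v)) / moranW r S := by
  unfold moranStep
  simp_rw [Finset.sum_mul]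
  rw [Finset.sum_comm]
  simp_rw [Finset.sum_div]
  refine Finset.sum_congr rfl fun u _ => ?_
  rw [Finset.sum_comm]
  refine Finset.sum_congr rfl fun v _ => ?_
  rw [Finset.sum_eq_single (upd S u v)]
  · simp only [upd, rate, if_true, mul_one]; ring
  · intro T _ hT
    have : ¬ ((if u ∈ S then insert v S else S.erase v) = T) := fun h => hT h.symm
    rw [if_neg this]; ring
  · simp

lemma W_pos [Nonempty V] (r : ℝ) (hr : 1 < r) (S : Finset V) : 0 < moranW r S := by
  rw [← rate_sum]
  apply Finset.sum_pos
  · intro u _; unfold rate; split_ifs <;> linarith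
  · exact Finset.univ_nonempty

lemma rate_nonneg (r : ℝ) (hr : 1 < r) (S : Finset V) (u : V) : 0 ≤ rate r S u := by
  unfold rate; split_ifs <;> linarith

lemma step_nonneg [Nonempty V] (r : ℝ) (hr : 1 < r) (w : V → V → ℝ)
    (hw : ∀ u v, 0 ≤ w u v) (S T : Finset V) : 0 ≤ moranStep r w S T := by
  unfold moranStep
  refine Finset.sum_nonneg fun u _ => Finset.sum_nonneg fun v _ => ?_
  have h1 := W_pos r hr S
  have h2 := hw u v
  have h3 := rate_nonneg r hr S u
  unfold rate at h3
  have : (0:ℝ) ≤ (if (if u ∈ S then insert v S else S.erase v) = T then 1 else 0) := by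
    split_ifs <;> norm_num
  positivity

lemma fix_le [Nonempty V] (r : ℝ) (hr : 1 < r) (w : V → V → ℝ)
    (hw : ∀ u v, 0 ≤ w u v) (hw1 : ∀ u, ∑ v, w u v = 1) (f : Finset V → ℝ)
    (hf1 : ∀ S, f S ≤ 1) (hfu : f Finset.univ = 0)
    (gen : ∀ S, 0 ≤ ∑ u, ∑ v, rate r S u * w u v * (f (upd S u v) - f S))
    (init : Finset V → ℝ) (hi0 : ∀ S, 0 ≤ init S) (hi1 : ∑ S, init S = 1) :
    fixationProb r w init ≤ 1 - ∑ S, init S * f S := by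
  have hrs : ∀ S, ∑ u, ∑ v, rate r S u * w u v = moranW r S := by
    intro S
    simp_rw [← Finset.mul_sum, hw1, mul_one, rate_sum]
  have hone : ∀ S, ∑ T, moranStep r w S T = 1 := by
    intro S
    have := step_apply r w S (fun _ => 1)
    simp only [mul_one] at this
    rw [this, hrs, div_self (W_pos r hr S).ne']
  have hsub : ∀ S, f S ≤ ∑ T, moranStep r w S T * f T := by
    intro S
    rw [step_apply, le_div_iff₀ (W_pos r hr S), ← hrs S]
    have := gen S
    simp_rw [mul_sub, Finset.sum_sub_distrib, ← Finset.sum_mul] at this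
    linarith
  have key : ∀ t, (∀ S, 0 ≤ moranDist r w init t S) ∧ ∑ S, moranDist r w init t S = 1 ∧
      ∑ S, init S * f S ≤ ∑ S, moranDist r w init t S * f S := by
    intro t
    induction t with
    | zero => exact ⟨hi0, hi1, le_refl _⟩
    | succ t ih =>
      obtain ⟨h0, h1, h2⟩ := ih
      refine ⟨?_, ?_, ?_⟩
      · intro T
        exact Finset.sum_nonneg fun S _ => mul_nonneg (h0 S) (step_nonneg r hr w hw S T)
      · simp only [moranDist]
        rw [Finset.sum_comm]
        simp_rw [← Finset.mul_sum, hone, mul_one]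
        exact h1
      · simp only [moranDist]
        simp_rw [Finset.sum_mul]
        rw [Finset.sum_comm]
        refine h2.trans (Finset.sum_le_sum fun S _ => ?_)
        simp_rw [mul_assoc]
        rw [← Finset.mul_sum]
        exact mul_le_mul_of_nonneg_left (hsub S) (h0 S)
  unfold fixationProb
  apply ciSup_le
  intro t
  obtain ⟨h0, h1, h2⟩ := key t
  have h3 : moranDist r w init t Finset.univ ≤ ∑ S, moranDist r w init t S * (1 - f S) := by
    have := Finset.single_le_sum (f := fun S => moranDist r w init t S * (1 - f S))
      (fun S _ => mul_nonneg (h0 S) (by linarith [hf1 S])) (Finset.mem_univ (Finset.univ : Finset V))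
    simpa [hfu] using this
  simp_rw [mul_sub, Finset.sum_sub_distrib, mul_one] at h3
  linarith

lemma uniform_apply (f : Finset V → ℝ) :
    ∑ S, uniformSingleton V S * f S = (Fintype.card V : ℝ)⁻¹ * ∑ v : V, f {v} := by
  unfold uniformSingleton
  simp_rw [ite_mul, zero_mul]
  rw [← Finset.sum_filter]
  have : (Finset.univ.filter fun S : Finset V => S.card = 1)
      = Finset.univ.map ⟨fun v : V => ({v} : Finset V), Finset.singleton_injective⟩ := by
    ext S
    simp [Finset.card_eq_one, eq_comm]
  rw [this, Finset.sum_map, Finset.mul_sum]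
  rfl

lemma outW_nonneg (out : V → Finset V) (u v : V) : 0 ≤ outWeights out u v := by
  unfold outWeights; split_ifs <;> positivity

lemma outW_sum (out : V → Finset V) (u : V) (h : (out u).Nonempty) :
    ∑ v, outWeights out u v = 1 := by
  unfold outWeights
  rw [Finset.sum_ite_mem]
  have := h.card_pos
  simp
  field_simp

end MegaAux

open MegaAux

namespace MegaAux

variable {k ℓ m : ℕ}

abbrev R (k : ℕ) {ℓ m : ℕ} (p : Fin ℓ × Fin m) : MegastarV k ℓ m := Sum.inl p
abbrev A (k m : ℕ) {ℓ : ℕ} (i : Fin ℓ) : MegastarV k ℓ m := Sum.inr (Sum.inl i)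
abbrev C (m : ℕ) {ℓ k : ℕ} (p : Fin ℓ × Fin k) : MegastarV k ℓ m :=
  Sum.inr (Sum.inr (Sum.inl p))
abbrev ctr (k ℓ m : ℕ) : MegastarV k ℓ m := Sum.inr (Sum.inr (Sum.inr ()))

noncomputable abbrev mw (k ℓ m : ℕ) := outWeights (megastarOut k ℓ m)

lemma mw_RA (p : Fin ℓ × Fin m) (v) : mw k ℓ m (R k p) v = if v = A k m p.1 then 1 else 0 := by
  simp [outWeights, megastarOut]

lemma mw_A (i : Fin ℓ) (v) :
    mw k ℓ m (A k m i) v = if ∃ x, C m (i, x) = v then (k:ℝ)⁻¹ else 0 := by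
  simp only [outWeights, megastarOut]
  rw [Finset.card_image_of_injective]
  · simp
  · intro x y h; simpa using h

lemma mw_C (hk : 0 < k) (p : Fin ℓ × Fin k) (v) :
    mw k ℓ m (C m p) v =
      if (∃ y, y ≠ p.2 ∧ C m (p.1, y) = v) ∨ v = ctr k ℓ m then (k:ℝ)⁻¹ else 0 := by
  obtain ⟨i, x⟩ := p
  simp only [outWeights, megastarOut]
  rw [Finset.card_union_of_disjoint, Finset.card_image_of_injective]
  · rw [Finset.card_erase_of_mem (Finset.mem_univ _)]
    simp [Nat.sub_add_cancel hk, or_comm]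
  · intro x y h; simpa using h
  · simp

lemma mw_ctr (v) :
    mw k ℓ m (ctr k ℓ m) v = if ∃ p, R k p = v then ((ℓ:ℝ) * m)⁻¹ else 0 := by
  simp only [outWeights, megastarOut]
  rw [Finset.card_image_of_injective]
  · simp
  · intro x y h; simpa using h

lemma out_ne (hk : 0 < k) (hℓ : 0 < ℓ) (hm : 0 < m) (u) : (megastarOut k ℓ m u).Nonempty := by
  haveI : Nonempty (Fin k) := ⟨⟨0, hk⟩⟩
  haveI : Nonempty (Fin ℓ) := ⟨⟨0, hℓ⟩⟩
  haveI : Nonempty (Fin m) := ⟨⟨0, hm⟩⟩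
  rcases u with ⟨i, x⟩ | i | ⟨i, x⟩ | _
  · simp [megastarOut]
  · simp [megastarOut]
  · simp [megastarOut]
  · simp [megastarOut]

/-- In-weight of each non-reservoir vertex is at least one. -/
lemma in_weight (hk : 0 < k) (hℓ : 0 < ℓ) (hm : 0 < m) (v : MegastarV k ℓ m)
    (hv : v.isRight) : 1 ≤ ∑ u, mw k ℓ m u v := by
  have hk' : (k:ℝ) ≠ 0 := by positivity
  rcases v with p | i | ⟨i, x⟩ | _
  · simp at hv
  · rw [Fintype.sum_sum_type]
    have h1 : ∑ p : Fin ℓ × Fin m, mw k ℓ m (Sum.inl p) (Sum.inr (Sum.inl i)) = m := by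
      simp_rw [mw_RA, Fintype.sum_prod_type]
      simp
    rw [h1]
    have h2 : 0 ≤ ∑ u, mw k ℓ m (Sum.inr u) (Sum.inr (Sum.inl i)) :=
      Finset.sum_nonneg fun u _ => outW_nonneg _ _ _
    have : (1:ℝ) ≤ m := by exact_mod_cast hm
    linarith
  · rw [Fintype.sum_sum_type, Fintype.sum_sum_type, Fintype.sum_sum_type]
    have h0 : ∑ p : Fin ℓ × Fin m, mw k ℓ m (Sum.inl p) (C m (i, x)) = 0 := by
      simp_rw [mw_RA]; simp
    have h1 : ∑ j : Fin ℓ, mw k ℓ m (Sum.inr (Sum.inl j)) (C m (i, x)) = (k:ℝ)⁻¹ := by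
      simp_rw [mw_A]
      simp
    have h2 : ∑ p : Fin ℓ × Fin k, mw k ℓ m (Sum.inr (Sum.inr (Sum.inl p))) (C m (i, x))
        = ((k:ℝ) - 1) * (k:ℝ)⁻¹ := by
      simp_rw [mw_C hk, Fintype.sum_prod_type]
      have : ∀ (j : Fin ℓ) (z : Fin k),
          ((∃ y, y ≠ z ∧ C m (j, y) = C m (i, x)) ∨ C m (i, x) = ctr k ℓ m) ↔
            (j = i ∧ z ≠ x) := by
        intro j z
        simp only [Sum.inr.injEq, Sum.inl.injEq, Prod.mk.injEq, reduceCtorEq, or_false]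
        constructor
        · rintro ⟨y, g1, g2, g3⟩; subst g3; exact ⟨g2, g1.symm⟩
        · rintro ⟨h1, h2⟩; exact ⟨x, h2.symm, h1, rfl⟩
      simp_rw [this, ite_and]
      rw [Finset.sum_comm]
      simp only [Finset.sum_ite_eq', Finset.mem_univ, if_true]
      rw [← Finset.sum_filter, Finset.filter_ne']
      rw [Finset.sum_const, Finset.card_erase_of_mem (Finset.mem_univ _), nsmul_eq_mul]
      simp [Nat.cast_sub (show 1 ≤ k from hk)]
    rw [h0, h1, h2]
    have h3 : 0 ≤ ∑ u : Unit, mw k ℓ m (Sum.inr (Sum.inr (Sum.inr u))) (C m (i, x)) :=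
      Finset.sum_nonneg fun u _ => outW_nonneg _ _ _
    have : (k:ℝ)⁻¹ + ((k:ℝ) - 1) * (k:ℝ)⁻¹ = 1 := by field_simp; ring
    linarith
  · have hge : ∑ p : Fin ℓ × Fin k, mw k ℓ m (C m p) (ctr k ℓ m) = ℓ := by
      simp_rw [mw_C hk]
      simp
      field_simp
    rw [Fintype.sum_sum_type, Fintype.sum_sum_type, Fintype.sum_sum_type]
    have h1 : ∀ {ι : Type} [Fintype ι] (g : ι → MegastarV k ℓ m) (v),
        0 ≤ ∑ u, mw k ℓ m (g u) v :=
      fun g v => Finset.sum_nonneg fun u _ => outW_nonneg _ _ _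
    have a1 := h1 (fun p => Sum.inl p) (ctr k ℓ m)
    have a2 := h1 (fun p => Sum.inr (Sum.inl p)) (ctr k ℓ m)
    have a3 := h1 (fun p => Sum.inr (Sum.inr (Sum.inr p))) (ctr k ℓ m)
    have : (1:ℝ) ≤ ℓ := by exact_mod_cast hℓ
    unfold C ctr at *
    linarith

/-- Test function for case A. -/
noncomputable def fA (c : ℝ) (S : Finset (MegastarV k ℓ m)) : ℝ :=
  open Classical in
  if S = ∅ then 1 else if ∃ v : MegastarV k ℓ m, v.isRight ∧ S = {v} then c else 0

lemma gen_empty (r : ℝ) (w : MegastarV k ℓ m → MegastarV k ℓ m → ℝ)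
    (f : Finset (MegastarV k ℓ m) → ℝ) :
    0 ≤ ∑ u, ∑ v, rate r ∅ u * w u v * (f (upd ∅ u v) - f ∅) := by
  simp [upd]

lemma genA (r : ℝ) (hr : 1 < r) (hk : 0 < k) (hℓ : 0 < ℓ) (hm : 0 < m)
    (S : Finset (MegastarV k ℓ m)) :
    0 ≤ ∑ u, ∑ v, rate r S u * mw k ℓ m u v *
      (fA (1 / (1 + r)) (upd S u v) - fA (1 / (1 + r)) S) := by
  classical
  set c := 1 / (1 + r) with hc
  have hc0 : 0 ≤ c := by positivity
  have hfn : ∀ S : Finset (MegastarV k ℓ m), 0 ≤ fA c S := by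
    intro S; unfold fA; split_ifs <;> linarith
  have hrc : 1 - c = r * c := by rw [hc]; field_simp; ring
  by_cases h0 : S = ∅
  · subst h0; exact gen_empty _ _ _
  by_cases h1 : ∃ v : MegastarV k ℓ m, v.isRight ∧ S = {v}
  · have hfS : fA c S = c := by unfold fA; rw [if_neg h0, if_pos h1]
    obtain ⟨x, hx, rfl⟩ := h1
    rw [hfS]
    have hfe : fA c (∅ : Finset (MegastarV k ℓ m)) = 1 := by simp [fA]
    have hxx : mw k ℓ m x x = 0 := by
      rcases x with p | i | ⟨i, x⟩ | _
      · simp at hx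
      · rw [mw_A]; simp
      · rw [mw_C hk]; simp
      · rw [mw_ctr]; simp
    have hterm : ∀ u, mw k ℓ m u x * (1 - c) - (if u = x then r * c else 0) ≤
        ∑ v, rate r {x} u * mw k ℓ m u v * (fA c (upd {x} u v) - c) := by
      intro u
      by_cases hu : u = x
      · subst hu
        rw [if_pos rfl, hxx, zero_mul, zero_sub]
        have : ∑ v, mw k ℓ m u v * (-(r * c)) = -(r * c) := by
          rw [← Finset.sum_mul, outW_sum _ _ (out_ne hk hℓ hm u), one_mul]
        rw [← this]
        refine Finset.sum_le_sum fun v _ => ?_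
        have a := outW_nonneg (megastarOut k ℓ m) u v
        have b := hfn (upd {u} u v)
        have : rate r {u} u = r := by simp [rate]
        rw [this]
        have : 0 ≤ r * mw k ℓ m u v * fA c (upd {u} u v) := by
          apply mul_nonneg (mul_nonneg (by linarith) a) b
        linarith
      · rw [if_neg hu, sub_zero]
        rw [Finset.sum_eq_single x]
        · simp [rate, hu, upd, hfe]
        · intro v _ hv
          have : upd {x} u v = {x} := by
            simp [upd, hu, hv]
          rw [this, hfS]; ring
        · simp
    refine le_trans ?_ (Finset.sum_le_sum fun u _ => hterm u)
    rw [Finset.sum_sub_distrib, ← Finset.sum_mul]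
    simp only [Finset.sum_ite_eq', Finset.mem_univ, if_true]
    rw [← hrc]
    have := in_weight hk hℓ hm x hx
    have h1c : 0 ≤ 1 - c := by rw [hrc]; positivity
    nlinarith
  · have hfS : fA c S = 0 := by unfold fA; rw [if_neg h0, if_neg h1]
    rw [hfS]
    refine Finset.sum_nonneg fun u _ => Finset.sum_nonneg fun v _ => ?_
    rw [sub_zero]
    exact mul_nonneg (mul_nonneg (rate_nonneg r hr S u) (outW_nonneg _ _ _)) (hfn _)

/-- Test function for case B. -/
noncomputable def fB (p q : ℝ) (S : Finset (MegastarV k ℓ m)) : ℝ :=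
  open Classical in
  if S = ∅ then 1 else if ∃ x : Fin ℓ × Fin m, S = {R k x} then p
  else if ∃ x : Fin ℓ × Fin m, S = {R k x, A k m x.1} then q else 0

lemma genB (r : ℝ) (hr : 1 < r) (hk : 0 < k) (hℓ : 0 < ℓ) (hm : 0 < m) (p q : ℝ)
    (hp : 0 ≤ p) (hq : 0 ≤ q) (hqp : q ≤ p) (hp1 : p ≤ 1)
    (c1 : 0 ≤ ((ℓ:ℝ) * m)⁻¹ * (1 - p) + r * (q - p))
    (c2 : 0 ≤ ((m:ℝ) - 1) * (p - q) - (r + ((ℓ:ℝ) * m)⁻¹) * q)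
    (S : Finset (MegastarV k ℓ m)) :
    0 ≤ ∑ u, ∑ v, rate r S u * mw k ℓ m u v * (fB p q (upd S u v) - fB p q S) := by
  classical
  have hfn : ∀ S : Finset (MegastarV k ℓ m), 0 ≤ fB p q S := by
    intro S; unfold fB; split_ifs <;> linarith
  have hfe : fB p q (∅ : Finset (MegastarV k ℓ m)) = 1 := by simp [fB]
  have hfR : ∀ x : Fin ℓ × Fin m, fB p q {R k x} = p := by
    intro x; unfold fB; rw [if_neg (Finset.singleton_ne_empty _), if_pos ⟨x, rfl⟩]
  have hfRA : ∀ x : Fin ℓ × Fin m, fB p q {R k x, A k m x.1} = q := by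
    intro x
    unfold fB
    rw [if_neg (Finset.insert_ne_empty _ _), if_neg, if_pos ⟨x, rfl⟩]
    rintro ⟨y, hy⟩
    have : A k m x.1 ∈ ({R k y} : Finset (MegastarV k ℓ m)) := by
      rw [← hy]; simp
    simp at this
  by_cases h0 : S = ∅
  · subst h0; exact gen_empty _ _ _
  by_cases h1 : ∃ x : Fin ℓ × Fin m, S = {R k x}
  · obtain ⟨x, rfl⟩ := h1
    rw [hfR]
    have hterm : ∀ u : MegastarV k ℓ m, (if u = ctr k ℓ m then ((ℓ:ℝ) * m)⁻¹ * (1 - p) else 0)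
        + (if u = R k x then r * (q - p) else 0) ≤
        ∑ v, rate r {R k x} u * mw k ℓ m u v * (fB p q (upd {R k x} u v) - p) := by
      intro u
      by_cases hu : u = R k x
      · subst hu
        rw [if_neg (by simp), if_pos rfl, zero_add]
        rw [Finset.sum_eq_single (A k m x.1)]
        · rw [mw_RA]
          have : upd {R k x} (R k x) (A k m x.1) = {R k x, A k m x.1} := by
            simp [upd, Finset.pair_comm]
          rw [this, hfRA]
          simp [rate]
        · intro v _ hv
          rw [mw_RA, if_neg hv]; simp
        · simp
      · rw [if_neg hu, add_zero, Finset.sum_eq_single (R k x)]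
        · have : upd {R k x} u (R k x) = ∅ := by
            simp [upd, hu]
          rw [this, hfe]
          have h1 : rate r {R k x} u = 1 := by simp [rate, hu]
          rw [h1, one_mul]
          split_ifs with hc
          · subst hc
            rw [mw_ctr, if_pos ⟨x, rfl⟩]
          · exact mul_nonneg (outW_nonneg _ _ _) (by linarith)
        · intro v _ hv
          have : upd {R k x} u v = {R k x} := by
            simp [upd, hu, hv]
          rw [this, hfR]; ring
        · simp
    refine le_trans ?_ (Finset.sum_le_sum fun u _ => hterm u)
    rw [Finset.sum_add_distrib]
    simp only [Finset.sum_ite_eq', Finset.mem_univ, if_true]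
    exact c1
  by_cases h2 : ∃ x : Fin ℓ × Fin m, S = {R k x, A k m x.1}
  · obtain ⟨x, rfl⟩ := h2
    rw [hfRA]
    set S : Finset (MegastarV k ℓ m) := {R k x, A k m x.1} with hS
    have hAS : A k m x.1 ∈ S := by simp [hS]
    have hRS : R k x ∈ S := by simp [hS]
    -- lower bound for each source vertex
    have hterm : ∀ u : MegastarV k ℓ m,
        (if u = ctr k ℓ m then -(((ℓ:ℝ) * m)⁻¹ * q) else 0)
        + (if u = A k m x.1 then - (r * q) else 0)
        + ((mw k ℓ m u (A k m x.1)) - (if u = R k x then 1 else 0)) * (p - q) ≤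
        ∑ v, rate r S u * mw k ℓ m u v * (fB p q (upd S u v) - q) := by
      intro u
      by_cases huR : u = R k x
      · subst huR
        rw [if_neg (by simp), if_neg (by simp), if_pos rfl, mw_RA, if_pos rfl]
        rw [Finset.sum_eq_single (A k m x.1)]
        · have : upd S (R k x) (A k m x.1) = S := by
            rw [upd, if_pos hRS, Finset.insert_eq_of_mem hAS]
          rw [this, hfRA]; simp
        · intro v _ hv
          rw [mw_RA, if_neg hv]; simp
        · simp
      by_cases huA : u = A k m x.1
      · subst huA
        have h0 : mw k ℓ m (A k m x.1) (A k m x.1) = 0 := by rw [mw_A]; simp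
        rw [if_neg (by simp), if_pos rfl, if_neg (by simp), h0]
        have : ∑ v, mw k ℓ m (A k m x.1) v * (-(r * q)) = -(r * q) := by
          rw [← Finset.sum_mul, outW_sum _ _ (out_ne hk hℓ hm _), one_mul]
        have h3 : ∑ v, mw k ℓ m (A k m x.1) v * (-(r * q)) ≤
            ∑ v, rate r S (A k m x.1) * mw k ℓ m (A k m x.1) v *
              (fB p q (upd S (A k m x.1) v) - q) := by
          refine Finset.sum_le_sum fun v _ => ?_
          have a := outW_nonneg (megastarOut k ℓ m) (A k m x.1) v
          have b := hfn (upd S (A k m x.1) v)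
          have : rate r S (A k m x.1) = r := by simp [rate, hAS]
          rw [this]
          have : 0 ≤ r * mw k ℓ m (A k m x.1) v * fB p q (upd S (A k m x.1) v) :=
            mul_nonneg (mul_nonneg (by linarith) a) b
          linarith
        linarith
      have huS : u ∉ S := by simp [hS, huR, huA]
      rw [if_neg huR, if_neg huA, add_zero, sub_zero]
      have hrate : rate r S u = 1 := by simp [rate, huS]
      have hv : ∀ v, (if v = R k x then (if u = ctr k ℓ m then -(((ℓ:ℝ) * m)⁻¹ * q) else 0) else 0)
          + (if v = A k m x.1 then (mw k ℓ m u (A k m x.1)) * (p - q) else 0) ≤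
          rate r S u * mw k ℓ m u v * (fB p q (upd S u v) - q) := by
        intro v
        rw [hrate, one_mul]
        by_cases hvR : v = R k x
        · subst hvR
          rw [if_pos rfl, if_neg (show ¬ (R k x = A k m x.1) by simp), add_zero]
          have hw : mw k ℓ m u (R k x) = if u = ctr k ℓ m then ((ℓ:ℝ) * m)⁻¹ else 0 := by
            rcases u with y | i | y | _
            · rw [mw_RA]; simp
            · rw [mw_A]; simp
            · rw [mw_C hk]; simp
            · rw [mw_ctr]; simp
          rw [hw]
          split_ifs
          · have := hfn (upd S u (R k x))
            have h4 : 0 ≤ ((ℓ:ℝ) * m)⁻¹ * fB p q (upd S u (R k x)) := by positivity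
            linarith
          · simp
        by_cases hvA : v = A k m x.1
        · subst hvA
          rw [if_neg (show ¬ (A k m x.1 = R k x) by simp), if_pos rfl, zero_add]
          have : upd S u (A k m x.1) = {R k x} := by
            rw [upd, if_neg huS]
            ext z
            simp only [hS, Finset.mem_erase, Finset.mem_insert, Finset.mem_singleton]
            constructor
            · tauto
            · rintro rfl; simp
          rw [this, hfR]
        · rw [if_neg hvR, if_neg hvA]
          have : upd S u v = S := by
            rw [upd, if_neg huS, Finset.erase_eq_of_notMem]
            simp [hS, hvR, hvA]
          rw [this, hfRA]; simp
      refine le_trans ?_ (Finset.sum_le_sum fun v _ => hv v)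
      rw [Finset.sum_add_distrib]
      simp only [Finset.sum_ite_eq', Finset.mem_univ, if_true]
      exact le_refl _
    refine le_trans ?_ (Finset.sum_le_sum fun u _ => hterm u)
    rw [Finset.sum_add_distrib, Finset.sum_add_distrib, ← Finset.sum_mul, Finset.sum_sub_distrib]
    simp only [Finset.sum_ite_eq', Finset.mem_univ, if_true]
    have hin : (m:ℝ) ≤ ∑ u, mw k ℓ m u (A k m x.1) := by
      rw [Fintype.sum_sum_type]
      have h1 : ∑ p : Fin ℓ × Fin m, mw k ℓ m (Sum.inl p) (A k m x.1) = m := by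
        simp_rw [mw_RA, Fintype.sum_prod_type]
        simp
      rw [h1]
      have h2 : 0 ≤ ∑ u, mw k ℓ m (Sum.inr u) (A k m x.1) :=
        Finset.sum_nonneg fun u _ => outW_nonneg _ _ _
      linarith
    nlinarith
  · have hfS : fB p q S = 0 := by unfold fB; rw [if_neg h0, if_neg h1, if_neg h2]
    rw [hfS]
    refine Finset.sum_nonneg fun u _ => Finset.sum_nonneg fun v _ => ?_
    rw [sub_zero]
    exact mul_nonneg (mul_nonneg (rate_nonneg r hr S u) (outW_nonneg _ _ _)) (hfn _)

lemma card_V : Fintype.card (MegastarV k ℓ m) = 1 + ℓ * (m + 1 + k) := by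
  simp; ring

lemma main_fix (r : ℝ) (hr : 1 < r) (hk : 0 < k) (hℓ : 0 < ℓ) (hm : 0 < m)
    (f : Finset (MegastarV k ℓ m) → ℝ)
    (hf1 : ∀ S, f S ≤ 1) (hfu : f Finset.univ = 0)
    (gen : ∀ S, 0 ≤ ∑ u, ∑ v, rate r S u * mw k ℓ m u v * (f (upd S u v) - f S)) :
    fixationProb r (mw k ℓ m) (uniformSingleton (MegastarV k ℓ m)) ≤
      1 - (Fintype.card (MegastarV k ℓ m) : ℝ)⁻¹ * ∑ v, f {v} := by
  haveI : Nonempty (MegastarV k ℓ m) := ⟨ctr k ℓ m⟩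
  rw [← uniform_apply]
  apply fix_le r hr _ (fun u v => outW_nonneg _ u v)
    (fun u => outW_sum _ u (out_ne hk hℓ hm u)) f hf1 hfu gen
  · intro S; unfold uniformSingleton; split_ifs <;> positivity
  · have := uniform_apply (V := MegastarV k ℓ m) (fun _ => 1)
    simp only [mul_one] at this
    rw [this, Finset.sum_const, Finset.card_univ, nsmul_eq_mul, mul_one, inv_mul_cancel₀]
    exact_mod_cast Fintype.card_ne_zero

lemma boundA (r : ℝ) (hr : 1 < r) (hk : 0 < k) (hℓ : 0 < ℓ) (hm : 0 < m) :
    fixationProb r (mw k ℓ m) (uniformSingleton (MegastarV k ℓ m)) ≤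
      1 - (Fintype.card (MegastarV k ℓ m) : ℝ)⁻¹ * ((1 + ℓ * (1 + k)) * (1 / (1 + r))) := by
  classical
  have h := main_fix r hr hk hℓ hm (fA (1 / (1 + r))) ?_ ?_ (genA r hr hk hℓ hm)
  · refine h.trans (le_of_eq ?_)
    congr 2
    rw [Fintype.sum_sum_type]
    have h1 : ∀ x : Fin ℓ × Fin m, fA (k := k) (1 / (1 + r)) {Sum.inl x} = 0 := by
      intro x; unfold fA
      rw [if_neg (Finset.singleton_ne_empty _), if_neg]
      rintro ⟨v, hv, h⟩
      rw [Finset.singleton_inj] at h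
      subst h; simp at hv
    have h2 : ∀ x, fA (k := k) (ℓ := ℓ) (m := m) (1 / (1 + r)) {Sum.inr x} = 1 / (1 + r) := by
      intro x; unfold fA
      rw [if_neg (Finset.singleton_ne_empty _), if_pos ⟨_, by simp, rfl⟩]
    simp only [h1, h2, Finset.sum_const, Finset.card_univ, nsmul_eq_mul, mul_zero, zero_add]
    congr 1
    simp
    ring
  · intro S
    have : 1 / (1 + r) ≤ 1 := by rw [div_le_one] <;> linarith
    unfold fA; split_ifs <;> linarith
  · unfold fA
    rw [if_neg, if_neg]
    · rintro ⟨v, _, h⟩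
      have h1 : R k (⟨0, hℓ⟩, ⟨0, hm⟩) ∈ ({v} : Finset (MegastarV k ℓ m)) := by
        rw [← h]; simp
      have h2 : ctr k ℓ m ∈ ({v} : Finset (MegastarV k ℓ m)) := by
        rw [← h]; simp
      rw [Finset.mem_singleton] at h1 h2
      rw [← h1] at h2; simp at h2
    · exact (Finset.univ_nonempty_iff.2 ⟨ctr k ℓ m⟩).ne_empty

lemma boundB (r : ℝ) (hr : 1 < r) (hk : 0 < k) (hℓ : 0 < ℓ) (hm : 0 < m)
    (hmr : 2 * r ≤ m) :
    fixationProb r (mw k ℓ m) (uniformSingleton (MegastarV k ℓ m)) ≤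
      1 - (Fintype.card (MegastarV k ℓ m) : ℝ)⁻¹ * ((ℓ * m) * (1 / (3 * r ^ 2 * ℓ))) := by
  classical
  have hℓ1 : (1:ℝ) ≤ ℓ := by exact_mod_cast hℓ
  have hm1 : (1:ℝ) ≤ m := by exact_mod_cast hm
  set p : ℝ := 1 / (3 * r ^ 2 * ℓ) with hp
  have hp0 : 0 ≤ p := by positivity
  have hr2 : 1 ≤ r ^ 2 * ℓ := by nlinarith [mul_nonneg (by positivity : 0 ≤ r ^ 2) (by linarith : (0:ℝ) ≤ ℓ - 1)]
  have hpe : p * (3 * (r ^ 2 * ℓ)) = 1 := by rw [hp]; field_simp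
  have hp1 : p ≤ 1 := by nlinarith
  set δ : ℝ := 2 * r / m with hδ
  have hδ0 : 0 ≤ δ := by positivity
  have hδ1 : δ ≤ 1 := by rw [hδ, div_le_one (by linarith)]; exact hmr
  have hδm : δ * m = 2 * r := by rw [hδ]; field_simp
  set d : ℝ := ((ℓ:ℝ) * m)⁻¹ with hd
  have hd0 : 0 ≤ d := by positivity
  have hd1 : d ≤ 1 := by
    rw [hd]; apply inv_le_one_of_one_le₀; nlinarith
  have hg := genB r hr hk hℓ hm p (p * (1 - δ)) hp0 (mul_nonneg hp0 (by linarith)) (by nlinarith)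
    hp1 ?_ ?_
  · have h := main_fix r hr hk hℓ hm (fB p (p * (1 - δ))) ?_ ?_ hg
    · refine h.trans ?_
      have h3 : (ℓ * m) * p ≤ ∑ v, fB (k := k) (ℓ := ℓ) (m := m) p (p * (1 - δ)) {v} := by
        rw [Fintype.sum_sum_type]
        have h1 : ∀ x : Fin ℓ × Fin m, fB (k := k) p (p * (1 - δ)) {Sum.inl x} = p := by
          intro x; unfold fB
          rw [if_neg (Finset.singleton_ne_empty _), if_pos ⟨x, rfl⟩]
        have h2 : ∀ S, 0 ≤ fB (k := k) (ℓ := ℓ) (m := m) p (p * (1 - δ)) S := by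
          intro S; unfold fB; split_ifs <;> first | positivity | nlinarith
        simp only [h1, Finset.sum_const, Finset.card_univ, nsmul_eq_mul]
        have := Finset.sum_nonneg fun (u : Fin ℓ ⊕ ((Fin ℓ × Fin k) ⊕ Unit)) (_ : u ∈ Finset.univ) =>
          h2 {Sum.inr u}
        simp only [Fintype.card_prod, Fintype.card_fin, Nat.cast_mul]
        linarith
      have := mul_le_mul_of_nonneg_left h3
        (by positivity : 0 ≤ (Fintype.card (MegastarV k ℓ m) : ℝ)⁻¹)
      linarith
    · intro S
      unfold fB; split_ifs <;> nlinarith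
    · unfold fB
      have hc : ctr k ℓ m ∈ (Finset.univ : Finset (MegastarV k ℓ m)) := Finset.mem_univ _
      rw [if_neg, if_neg, if_neg]
      · rintro ⟨x, h⟩
        rw [h] at hc; simp at hc
      · rintro ⟨x, h⟩
        rw [h] at hc; simp at hc
      · intro h
        rw [h] at hc; simp at hc
  · have h1 : d * (ℓ * m) = 1 := by rw [hd]; field_simp
    have h2 : r * δ = 2 * (r ^ 2 * ℓ) * d := by
      have : r * δ = r * (δ * m) * (ℓ * d) := by
        have : (m:ℝ) * (ℓ * d) = 1 := by linarith
        calc r * δ = r * δ * 1 := by ring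
          _ = _ := by rw [← this]; ring
      rw [this, hδm]; ring
    have h3 : d * (1 - p) + r * (p * (1 - δ) - p) = d * (1 - p * (1 + 2 * (r ^ 2 * ℓ))) := by
      have : r * (p * (1 - δ) - p) = - (p * (r * δ)) := by ring
      rw [this, h2]; ring
    rw [h3]
    apply mul_nonneg hd0
    nlinarith
  · have : ((m:ℝ) - 1) * (p - p * (1 - δ)) - (r + d) * (p * (1 - δ))
        = p * (δ * m + δ * (r + d - 1) - (r + d)) := by ring
    rw [this, hδm]
    apply mul_nonneg hp0
    nlinarith [mul_nonneg hδ0 (by linarith : 0 ≤ r + d - 1)]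

end MegaAux

theorem megastar_fixation_upper_bound (r : ℝ) (hr : 1 < r) (k ℓ m : ℕ)
    (hk : 0 < k) (hℓ : 0 < ℓ) (hm : 0 < m) :
    ∀ n : ℕ, n = 1 + ℓ * (m + 1 + k) →
      fixationProb r (outWeights (megastarOut k ℓ m))
          (uniformSingleton (MegastarV k ℓ m)) ≤
        1 - 1 / (52 * r ^ 2 * Real.sqrt (n : ℝ)) := by
  intro n hn
  have hA := boundA r hr hk hℓ hm
  have hB := boundB r hr hk hℓ hm
  rw [card_V, ← hn] at hA hB
  have hnR : (n:ℝ) = 1 + ℓ * (m + 1 + k) := by rw [hn]; push_cast; ring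
  have hℓ1 : (1:ℝ) ≤ ℓ := by exact_mod_cast hℓ
  have hm1 : (1:ℝ) ≤ m := by exact_mod_cast hm
  have hk1 : (1:ℝ) ≤ k := by exact_mod_cast hk
  have hn1 : (1:ℝ) ≤ n := by rw [hnR]; nlinarith
  set s := Real.sqrt (n:ℝ) with hs
  have hss : s * s = n := Real.mul_self_sqrt (by linarith)
  have hs1 : 1 ≤ s := by rw [hs]; exact Real.one_le_sqrt.2 hn1
  set N : ℝ := 1 + ℓ * (1 + k) with hN
  by_cases hc : s ≤ 26 * r * N
  · refine hA.trans ?_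
    suffices 1 / (52 * r ^ 2 * s) ≤ (n:ℝ)⁻¹ * (N * (1 / (1 + r))) by linarith
    have e : (n:ℝ)⁻¹ * (N * (1 / (1 + r))) = N / (s * s * (1 + r)) := by
      rw [hss]; field_simp
    rw [e, div_le_div_iff₀ (by positivity) (by positivity)]
    have h1 : s * (1 + r) ≤ 26 * r * N * (2 * r) := by
      apply mul_le_mul hc (by linarith) (by linarith); nlinarith
    nlinarith
  · push Not at hc
    have hN2 : 2 * (ℓ:ℝ) ≤ N := by rw [hN]; nlinarith
    have hℓs : 52 * r * ℓ ≤ s := by nlinarith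
    have hN26 : 26 * N ≤ s := by nlinarith
    have hlm : (ℓ:ℝ) * m = s * s - N := by rw [hss, hnR, hN]; ring
    have hhalf : s * s / 2 ≤ (ℓ:ℝ) * m := by rw [hlm]; nlinarith
    have hmr : 2 * r ≤ (m:ℝ) := by
      by_contra hlt
      push Not at hlt
      have : (ℓ:ℝ) * m ≤ ℓ * (2 * r) := by nlinarith
      nlinarith
    refine (hB hmr).trans ?_
    suffices 1 / (52 * r ^ 2 * s) ≤ (n:ℝ)⁻¹ * (ℓ * m * (1 / (3 * r ^ 2 * ℓ))) by linarith
    have e : (n:ℝ)⁻¹ * (ℓ * m * (1 / (3 * r ^ 2 * ℓ))) = (ℓ * m) / (s * s * (3 * r ^ 2 * ℓ)) := by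
      rw [hss]; field_simp
    rw [e, div_le_div_iff₀ (by positivity) (by positivity)]
    have hls : (ℓ:ℝ) ≤ s := by nlinarith
    have h1 : s * s * (3 * r ^ 2 * ℓ) ≤ s * s * (3 * r ^ 2 * s) := by gcongr
    have h2 : s * s / 2 * (52 * r ^ 2 * s) ≤ (ℓ:ℝ) * m * (52 * r ^ 2 * s) := by gcongr
    have h3 : 0 ≤ s * s * (r ^ 2 * s) := by positivity
    nlinarith
end
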